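/- For every c > 0 there exist a constant C > 0 and a continuously differentiable function θ_{1/3} : (0,∞) → ℝ with θ_{1/3}′(t) = 2/(π t M_{1/3}(t)²) for all t > 0, such that for all real v ≥ 1 and all real z with 3/16 ≤ z ≤ 1 − c v^{−2/3}, one has | e^{πv/2} K_{iv}(vz) − π (w(z)^{1/2}/(1−z²)^{1/4}) M_{1/3}(v w(z)) sin(θ_{1/3}(v w(z))) | ≤ C v^{−4/3}. -/

import Mathlib

open Complex Finset Filter

noncomputable section

/-- The modified `K`-Bessel function of purely imaginary order:
`K_{iv}(u) = ∫₀^∞ e^{-u cosh t} cos(v t) dt`. -/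
def Kbes (v u : ℝ) : ℝ := ∫ t in Set.Ioi (0 : ℝ), Real.exp (-u * Real.cosh t) * Real.cos (v * t)

/-- `w(z) = arccosh(1/z) - √(1-z²)` for `0 < z < 1`,
where `arccosh(1/z) = log(1/z + √(1/z² - 1))`. -/
def wfun (z : ℝ) : ℝ :=
  Real.log (1 / z + Real.sqrt (1 / z ^ 2 - 1)) - Real.sqrt (1 - z ^ 2)

/-- The `J`-Bessel function `J_ν(x) = Σ_j (-1)^j/(j! Γ(j+ν+1)) (x/2)^{2j+ν}`. -/
def Jbes (ν x : ℝ) : ℝ :=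
  ∑' j : ℕ, ((-1 : ℝ) ^ j / ((j.factorial : ℝ) * Real.Gamma ((j : ℝ) + ν + 1))) *
    (x / 2) ^ (2 * (j : ℝ) + ν)

/-- The `Y`-Bessel function of order `1/3`:
`Y_{1/3}(x) = (J_{1/3}(x) cos(π/3) - J_{-1/3}(x)) / sin(π/3)`. -/
def Y13 (x : ℝ) : ℝ :=
  (Jbes (1/3) x * Real.cos (Real.pi / 3) - Jbes (-(1/3)) x) / Real.sin (Real.pi / 3)

/-- `M_{1/3}(x) = √(J_{1/3}(x)² + Y_{1/3}(x)²)`. -/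
def M13 (x : ℝ) : ℝ := Real.sqrt (Jbes (1/3) x ^ 2 + Y13 x ^ 2)

lemma energy_alg (P p q B δ : ℝ) (hB : 0 ≤ B) (h : |q| ≤ B * (|P| + δ)) :
    2 * p * q ≤ B * (P^2 + 2*p^2 + δ^2) := by
  have h1 : 2 * p * q ≤ 2 * |p| * (B * (|P| + δ)) := by
    calc 2 * p * q ≤ |2 * p * q| := le_abs_self _
      _ = 2 * |p| * |q| := by rw [abs_mul, abs_mul]; norm_num
      _ ≤ _ := by gcongr
  have h6 : 2 * |p| * (|P| + δ) ≤ P^2 + 2*p^2 + δ^2 := by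
    have a1 := sq_abs p
    have a2 := sq_abs P
    nlinarith [sq_nonneg (|p| - |P|), sq_nonneg (|p| - δ)]
  have h7 := mul_le_mul_of_nonneg_left h6 hB
  linarith

set_option maxHeartbeats 1000000 in
/-- energy estimate, first phase -/
lemma energy_phase1 (B D : ℝ) (hB : 0 ≤ B) (hD : 0 ≤ D) : ∃ C : ℝ, 0 < C ∧
    ∀ (l δ : ℝ) (y y1 h : ℝ → ℝ) (y0 y10 : ℝ), 1 ≤ l → 0 < δ →
    (∀ t, 0 < t → t ≤ 2 → HasDerivAt y (y1 t) t) →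
    (∀ t, 0 < t → t ≤ 2 → HasDerivAt y1 (-((l^3)^2 * (1 - Real.exp (-2*t))) * y t + h t) t) →
    (∀ t, 0 < t → t ≤ 2 → |h t| ≤ B * (|y t| + l^3 * δ)) →
    Tendsto y (nhdsWithin 0 (Set.Ioi 0)) (nhds y0) →
    Tendsto y1 (nhdsWithin 0 (Set.Ioi 0)) (nhds y10) →
    |y0| ≤ D * δ → |y10| ≤ D * l^2 * δ →
    ∀ t, 0 < t → t ≤ 2 → t * l^2 ≤ 1 → (y t)^2 + (y1 t)^2 / l^4 ≤ C * δ^2 := by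
  refine ⟨(2*D^2+1) * Real.exp (2+3*B), by positivity, ?_⟩
  intro l δ y y1 h y0 y10 hl hδ hy hy1 hh hl0 hl1 hy0 hy10
  have hlp : 0 < l := by linarith
  set K : ℝ := (2+3*B) * l^2 with hK
  set Φ : ℝ → ℝ := fun t => ((y t)^2 + (y1 t)^2 / l^4 + δ^2) * Real.exp (-K*t) with hΦ
  have hder : ∀ t, 0 < t → t ≤ 2 → HasDerivAt Φ
      ((2 * y t * y1 t + 2 * y1 t * (-((l^3)^2 * (1 - Real.exp (-2*t))) * y t + h t) / l^4) *
        Real.exp (-K*t) + ((y t)^2 + (y1 t)^2 / l^4 + δ^2) * (Real.exp (-K*t) * (-K))) t := by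
    intro t h0 h2
    have e1 : HasDerivAt (fun t => Real.exp (-K*t)) (Real.exp (-K*t) * (-K)) t := by
      have := ((hasDerivAt_id t).const_mul (-K)).exp
      simpa using this
    have e2 := ((hy t h0 h2).pow 2)
    have e3 := ((hy1 t h0 h2).pow 2).div_const (l^4)
    have e4 := ((e2.add e3).add_const (δ^2)).mul e1
    refine e4.congr_deriv ?_
    simp only [Pi.add_apply, Pi.pow_apply]
    push_cast
    ring
  have hanti : ∀ t, 0 < t → t ≤ 2 → t * l^2 ≤ 1 → AntitoneOn Φ (Set.Ioc 0 t) := by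
    intro t h0 h2 ht
    apply antitoneOn_of_deriv_nonpos (convex_Ioc 0 t)
    · intro x hx
      exact (hder x hx.1 (hx.2.trans h2)).continuousAt.continuousWithinAt
    · intro x hx
      rw [interior_Ioc] at hx
      exact (hder x hx.1 (hx.2.le.trans h2)).differentiableAt.differentiableWithinAt
    · intro x hx
      rw [interior_Ioc] at hx
      have hx2 : x ≤ 2 := hx.2.le.trans h2
      rw [(hder x hx.1 hx2).deriv]
      set P := y x
      set p := y1 x / l^2 with hp
      have hy1' : y1 x = p * l^2 := by rw [hp]; field_simp
      have hhx := hh x hx.1 hx2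
      set T2 := 1 - Real.exp (-2*x) with hT2
      have hT0 : 0 ≤ T2 := by
        have : Real.exp (-2*x) ≤ 1 := Real.exp_le_one_iff.2 (by linarith [hx.1])
        linarith
      have hT1 : T2 ≤ 2 * x := by
        have := Real.add_one_le_exp (-2*x); linarith
      have hTl : l^2 * T2 ≤ 2 := by nlinarith [hx.2, sq_nonneg l]
      have hTl0 : 0 ≤ l^2 * T2 := by positivity
      rw [hy1']
      have hre : (2 * P * (p*l^2) + 2 * (p*l^2) * (-((l^3)^2 * T2) * P + h x) / l^4) *
        Real.exp (-K*x) + (P^2 + (p*l^2)^2 / l^4 + δ^2) * (Real.exp (-K*x) * (-K))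
        = Real.exp (-K*x) * l^2 * (2 * P * p * (1 - l^2*T2) + 2 * p * (h x / l^4)
            - (2+3*B) * (P^2 + p^2 + δ^2)) := by
        rw [hK]; field_simp; ring
      rw [hre]
      apply mul_nonpos_of_nonneg_of_nonpos (by positivity)
      have h1 : 2 * P * p * (1 - l^2*T2) ≤ P^2 + p^2 := by
        have : |2 * P * p * (1 - l^2*T2)| ≤ |2*P*p| * 1 := by
          rw [abs_mul]; gcongr; rw [abs_le]; constructor <;> linarith
        have h3 : |2*P*p| ≤ P^2 + p^2 := by
          rw [abs_le]; constructor <;> nlinarith [sq_nonneg (P+p), sq_nonneg (P-p)]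
        linarith [le_abs_self (2 * P * p * (1 - l^2*T2))]
      have h4 : |h x / l^4| ≤ B * (|P| + δ) := by
        rw [abs_div, abs_of_pos (by positivity : (0:ℝ) < l^4), div_le_iff₀ (by positivity)]
        refine hhx.trans ?_
        rw [mul_assoc]
        apply mul_le_mul_of_nonneg_left _ hB
        have e1 : (1:ℝ) ≤ l^4 := one_le_pow₀ hl
        have e2 : l^3 ≤ l^4 := pow_le_pow_right₀ hl (by norm_num)
        nlinarith [abs_nonneg P]
      have h5 := energy_alg P p (h x / l^4) B δ hB h4
      linarith [sq_nonneg P, sq_nonneg p, sq_nonneg δ, mul_nonneg hB (sq_nonneg P), mul_nonneg hB (sq_nonneg p), mul_nonneg hB (sq_nonneg δ)]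
  intro t h0 h2 ht
  have hlim : Tendsto Φ (nhdsWithin 0 (Set.Ioi 0)) (nhds ((y0^2 + y10^2/l^4 + δ^2) * Real.exp (-K*0))) := by
    apply Tendsto.mul
    · exact ((hl0.pow 2).add ((hl1.pow 2).div_const _)).add_const _
    · have : Continuous (fun t:ℝ => Real.exp (-K*t)) := by fun_prop
      exact (this.tendsto 0).mono_left nhdsWithin_le_nhds
  have hle : Φ t ≤ (y0^2 + y10^2/l^4 + δ^2) * Real.exp (-K*0) := by
    apply ge_of_tendsto hlim
    have : Set.Ioc 0 t ∈ nhdsWithin (0:ℝ) (Set.Ioi 0) := Ioc_mem_nhdsGT h0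
    filter_upwards [this] with s hs
    exact hanti t h0 h2 ht hs ⟨h0, le_rfl⟩ hs.2
  have hy0s : y0^2 ≤ D^2 * δ^2 := by
    rw [← mul_pow]; exact sq_le_sq' (by linarith [abs_le.1 hy0]) (abs_le.1 hy0).2
  have hy10s : y10^2/l^4 ≤ D^2 * δ^2 := by
    rw [div_le_iff₀ (by positivity)]
    have : y10^2 ≤ (D * l^2*δ)^2 := sq_le_sq' (by linarith [abs_le.1 hy10]) (abs_le.1 hy10).2
    nlinarith
  simp only [mul_zero, Real.exp_zero, mul_one] at hle
  have h7 : Φ t ≤ (2*D^2+1) * δ^2 := by nlinarith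
  have h8 : (y t)^2 + (y1 t)^2 / l^4 + δ^2 = Φ t * Real.exp (K*t) := by
    simp only [hΦ]; rw [mul_assoc, ← Real.exp_add]; simp
  have h9 : Real.exp (K*t) ≤ Real.exp (2+3*B) := by
    apply Real.exp_le_exp.2; rw [hK]; nlinarith
  have h10 : Φ t * Real.exp (K*t) ≤ (2*D^2+1) * δ^2 * Real.exp (2+3*B) := by
    gcongr
  nlinarith [sq_nonneg δ]


lemma one_sub_exp_lower (t : ℝ) (h0 : 0 ≤ t) (h2 : t ≤ 2) :
    2 * t / 5 ≤ 1 - Real.exp (-2*t) := by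
  have h1 := Real.add_one_le_exp (2*t)
  have h3 : Real.exp (-2*t) = (Real.exp (2*t))⁻¹ := by rw [← Real.exp_neg]; ring_nf
  have h4 : (Real.exp (2*t))⁻¹ ≤ (2*t+1)⁻¹ := by
    apply inv_anti₀ (by linarith) h1
  have h5 : (2*t+1)⁻¹ ≤ 1 - 2*t/5 := by
    rw [inv_le_iff_one_le_mul₀ (by linarith)]
    nlinarith
  linarith

set_option maxHeartbeats 1000000 in
/-- energy estimate, second phase -/
lemma energy_phase2 (B : ℝ) (hB : 0 ≤ B)
    (l δ : ℝ) (y y1 h : ℝ → ℝ) (hl : 1 ≤ l) (hδ : 0 < δ)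
    (hy : ∀ t, 0 < t → t ≤ 2 → HasDerivAt y (y1 t) t)
    (hy1 : ∀ t, 0 < t → t ≤ 2 → HasDerivAt y1 (-((l^3)^2 * (1 - Real.exp (-2*t))) * y t + h t) t)
    (hh : ∀ t, 0 < t → t ≤ 2 → |h t| ≤ B * (|y t| + l^3 * δ))
    (t₀ t : ℝ) (ht0 : 0 < t₀) (h01 : t₀ ≤ t) (ht2 : t ≤ 2) :
    (y t)^2 ≤ ((y t₀)^2 + (y1 t₀)^2 / (l^6 * (1 - Real.exp (-2*t₀))) + δ^2) * Real.exp (8*B*2) := by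
  have hlp : 0 < l := by linarith
  set K : ℝ := 8*B with hK
  set Φ : ℝ → ℝ := fun t => ((y t)^2 + (y1 t)^2 / (l^6 * (1 - Real.exp (-2*t))) + δ^2) * Real.exp (-K*Real.sqrt t) with hΦ
  have hTpos : ∀ t, 0 < t → t ≤ 2 → 0 < 1 - Real.exp (-2*t) := by
    intro t h0 h2
    have := one_sub_exp_lower t h0.le h2
    have : 0 < 2*t/5 := by positivity
    linarith
  have hder : ∀ t, 0 < t → t ≤ 2 → HasDerivAt Φ
      ((2 * y t * y1 t + (2 * y1 t * (-((l^3)^2 * (1 - Real.exp (-2*t))) * y t + h t) * (l^6 * (1 - Real.exp (-2*t)))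
         - (y1 t)^2 * (l^6 * (2 * Real.exp (-2*t)))) / (l^6 * (1 - Real.exp (-2*t)))^2) *
        Real.exp (-K*Real.sqrt t) + ((y t)^2 + (y1 t)^2 / (l^6 * (1 - Real.exp (-2*t))) + δ^2) * (Real.exp (-K*Real.sqrt t) * (-K * (1 / (2 * Real.sqrt t))))) t := by
    intro t h0 h2
    have e1 : HasDerivAt (fun t => Real.exp (-K*Real.sqrt t)) (Real.exp (-K*Real.sqrt t) * (-K * (1 / (2 * Real.sqrt t)))) t := by
      exact ((Real.hasDerivAt_sqrt h0.ne').const_mul (-K)).exp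
    have e0 : HasDerivAt (fun t => l^6 * (1 - Real.exp (-2*t))) (l^6 * (2 * Real.exp (-2*t))) t := by
      have := ((((hasDerivAt_id t).const_mul (-2:ℝ)).exp).const_sub 1).const_mul (l^6)
      refine this.congr_deriv ?_
      simp only [id]; ring
    have e2 := ((hy t h0 h2).pow 2)
    have hne : l^6 * (1 - Real.exp (-2*t)) ≠ 0 := by
      have := hTpos t h0 h2
      positivity
    have e3 := ((hy1 t h0 h2).pow 2).div e0 hne
    have e4 := ((e2.add e3).add_const (δ^2)).mul e1
    refine e4.congr_deriv ?_
    simp only [Pi.add_apply, Pi.pow_apply, Pi.div_apply]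
    push_cast
    ring
  have hanti : AntitoneOn Φ (Set.Icc t₀ t) := by
    apply antitoneOn_of_deriv_nonpos (convex_Icc t₀ t)
    · intro x hx
      exact (hder x (ht0.trans_le hx.1) (hx.2.trans ht2)).continuousAt.continuousWithinAt
    · intro x hx
      rw [interior_Icc] at hx
      exact (hder x (ht0.trans hx.1) (hx.2.le.trans ht2)).differentiableAt.differentiableWithinAt
    · intro x hx
      rw [interior_Icc] at hx
      have hx2 : x ≤ 2 := hx.2.le.trans ht2
      have hx0 : 0 < x := ht0.trans hx.1
      rw [(hder x hx0 hx2).deriv]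
      set T := Real.sqrt (1 - Real.exp (-2*x)) with hT
      have hTT : 1 - Real.exp (-2*x) = T^2 := (Real.sq_sqrt (hTpos x hx0 hx2).le).symm
      have hTp : 0 < T := Real.sqrt_pos.2 (hTpos x hx0 hx2)
      rw [hTT]
      set r := Real.sqrt x with hr
      have hrp : 0 < r := Real.sqrt_pos.2 hx0
      have hrx : x = r^2 := (Real.sq_sqrt hx0.le).symm
      have hrT : r ≤ 2 * T := by
        have := one_sub_exp_lower x hx0.le hx2
        rw [hTT] at this
        refine (pow_le_pow_iff_left₀ (by positivity) (by positivity) (two_ne_zero)).1 ?_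
        nlinarith
      set P := y x
      set p := y1 x / (l^3*T) with hp
      have hy1' : y1 x = p * (l^3*T) := by rw [hp]; field_simp
      have hhx := hh x hx0 hx2
      rw [hy1']
      have hre : (2 * P * (p*(l^3*T)) + (2 * (p*(l^3*T)) * (-((l^3)^2 * T^2) * P + h x) * (l^6 * T^2)
         - (p*(l^3*T))^2 * (l^6 * (2 * Real.exp (-2*x)))) / (l^6 * T^2)^2) *
        Real.exp (-K*r) + (P^2 + (p*(l^3*T))^2 / (l^6 * T^2) + δ^2) * (Real.exp (-K*r) * (-K * (1 / (2 * r))))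
        = Real.exp (-K*r) * (2 * p * (h x / (l^3*T)) - 2 * p^2 * Real.exp (-2*x) / T^2
            - (4*B/r) * (P^2 + p^2 + δ^2)) := by
        rw [hK]; field_simp; ring
      rw [hre]
      apply mul_nonpos_of_nonneg_of_nonpos (by positivity)
      have h4 : |h x / (l^3*T)| ≤ (B / T) * (|P| + δ) := by
        rw [abs_div, abs_of_pos (by positivity : (0:ℝ) < l^3*T), div_le_iff₀ (by positivity)]
        refine hhx.trans ?_
        have : B / T * (|P| + δ) * (l^3 * T) = B * (l^3 * |P| + l^3 * δ) := by field_simp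
        rw [this]
        have e1 : (1:ℝ) ≤ l^3 := one_le_pow₀ hl
        gcongr
        nlinarith [abs_nonneg P]
      have h5 := energy_alg P p (h x / (l^3*T)) (B/T) δ (by positivity) h4
      have h6 : 2 * (B / T) ≤ 4 * B / r := by
        rw [le_div_iff₀ hrp, ← mul_div_assoc, div_mul_eq_mul_div, div_le_iff₀ hTp]
        nlinarith
      have h7 : 0 ≤ 2 * p^2 * Real.exp (-2*x) / T^2 := by positivity
      have h8 : (B/T) * (P^2 + 2*p^2 + δ^2) ≤ (2 * (B/T)) * (P^2 + p^2 + δ^2) := by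
        have : 0 ≤ B / T := by positivity
        have : 0 ≤ (B/T) * (P^2 + δ^2) := by positivity
        linarith
      have h9 : (2 * (B/T)) * (P^2 + p^2 + δ^2) ≤ (4 * B / r) * (P^2 + p^2 + δ^2) := by gcongr
      linarith
  have hle : Φ t ≤ Φ t₀ := hanti ⟨le_rfl, h01⟩ ⟨h01, le_rfl⟩ h01
  have htp : 0 < t := ht0.trans_le h01
  have h8 : (y t)^2 + (y1 t)^2 / (l^6 * (1 - Real.exp (-2*t))) + δ^2 = Φ t * Real.exp (K*Real.sqrt t) := by
    simp only [hΦ]; rw [mul_assoc, ← Real.exp_add]; simp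
  have h9 : (y t)^2 ≤ Φ t * Real.exp (K*Real.sqrt t) := by
    rw [← h8]
    have := hTpos t htp ht2
    have : 0 ≤ (y1 t)^2 / (l^6 * (1 - Real.exp (-2*t))) := by positivity
    nlinarith [sq_nonneg δ]
  have hpos0 : 0 ≤ (y t₀)^2 + (y1 t₀)^2 / (l^6 * (1 - Real.exp (-2*t₀))) + δ^2 := by
    have := hTpos t₀ ht0 (h01.trans ht2)
    positivity
  have h10 : Φ t₀ ≤ ((y t₀)^2 + (y1 t₀)^2 / (l^6 * (1 - Real.exp (-2*t₀))) + δ^2) := by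
    simp only [hΦ]
    apply mul_le_of_le_one_right hpos0
    apply Real.exp_le_one_iff.2
    have : 0 ≤ K * Real.sqrt t₀ := by positivity
    linarith
  have h11 : Real.exp (K*Real.sqrt t) ≤ Real.exp (8*B*2) := by
    apply Real.exp_le_exp.2
    rw [hK]
    have : Real.sqrt t ≤ 2 := by
      rw [Real.sqrt_le_left (by norm_num)]; linarith
    gcongr
  calc (y t)^2 ≤ Φ t * Real.exp (K*Real.sqrt t) := h9
    _ ≤ Φ t₀ * Real.exp (K*Real.sqrt t) := by gcongr
    _ ≤ ((y t₀)^2 + (y1 t₀)^2 / (l^6 * (1 - Real.exp (-2*t₀))) + δ^2) * Real.exp (K*Real.sqrt t) := by gcongr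
    _ ≤ _ := by gcongr

/-- energy estimate -/
lemma energy_main (B D : ℝ) (hB : 0 ≤ B) (hD : 0 ≤ D) : ∃ C : ℝ, 0 < C ∧
    ∀ (l δ : ℝ) (y y1 h : ℝ → ℝ) (y0 y10 : ℝ), 1 ≤ l → 0 < δ →
    (∀ t, 0 < t → t ≤ 2 → HasDerivAt y (y1 t) t) →
    (∀ t, 0 < t → t ≤ 2 → HasDerivAt y1 (-((l^3)^2 * (1 - Real.exp (-2*t))) * y t + h t) t) →
    (∀ t, 0 < t → t ≤ 2 → |h t| ≤ B * (|y t| + l^3 * δ)) →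
    Tendsto y (nhdsWithin 0 (Set.Ioi 0)) (nhds y0) →
    Tendsto y1 (nhdsWithin 0 (Set.Ioi 0)) (nhds y10) →
    |y0| ≤ D * δ → |y10| ≤ D * l^2 * δ →
    ∀ t, 0 < t → t ≤ 2 → |y t| ≤ C * δ := by
  obtain ⟨C, hC, H⟩ := energy_phase1 B D hB hD
  refine ⟨Real.sqrt ((4*C+1) * Real.exp (8*B*2)), by positivity, ?_⟩
  intro l δ y y1 h y0 y10 hl hδ hy hy1 hh hl0 hl1 hy0 hy10 t h0 h2
  have hlp : 0 < l := by linarith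
  have key : (y t)^2 ≤ ((4*C+1) * Real.exp (8*B*2)) * δ^2 := by
    have hexp : 1 ≤ Real.exp (8*B*2) := Real.one_le_exp (by positivity)
    by_cases ht : t * l^2 ≤ 1
    · have h1 := H l δ y y1 h y0 y10 hl hδ hy hy1 hh hl0 hl1 hy0 hy10 t h0 h2 ht
      have h3 : 0 ≤ (y1 t)^2 / l^4 := by positivity
      calc (y t)^2 ≤ C * δ^2 := by linarith
        _ ≤ ((4*C+1) * 1) * δ^2 := by gcongr; linarith
        _ ≤ _ := by gcongr
    · push Not at ht
      have hq : (1/l^2) * l^2 = 1 := by field_simp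
      have h3 : 1/l^2 ≤ t := by
        rw [div_le_iff₀ (by positivity)]; exact ht.le
      have h4 : 1/l^2 ≤ 1 := by
        rw [div_le_one (by positivity)]; exact one_le_pow₀ hl
      have h5 : 0 < 1/l^2 := by positivity
      have h1 := H l δ y y1 h y0 y10 hl hδ hy hy1 hh hl0 hl1 hy0 hy10 (1/l^2) h5 (by linarith) hq.le
      have h6 := energy_phase2 B hB l δ y y1 h hl hδ hy hy1 hh (1/l^2) t h5 h3 h2
      refine h6.trans ?_
      have h7 := one_sub_exp_lower (1/l^2) h5.le (by linarith)
      have h8 : (y1 (1/l^2))^2 / (l^6 * (1 - Real.exp (-2*(1/l^2)))) ≤ 3 * ((y1 (1/l^2))^2 / l^4) := by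
        have e1 : l^4 / 3 ≤ l^6 * (1 - Real.exp (-2*(1/l^2))) := by
          calc l^4/3 ≤ l^6 * (2 * (1/l^2)/5) := by
                have : l^6 * (2 * (1/l^2)/5) = 2 * l^4/5 := by field_simp
                rw [this]; have : 0 < l^4 := by positivity
                linarith
            _ ≤ _ := by gcongr
        calc _ ≤ (y1 (1/l^2))^2 / (l^4/3) := div_le_div_of_nonneg_left (by positivity) (by positivity) e1
          _ = _ := by field_simp
      have h9 : 0 ≤ (y (1/l^2))^2 := sq_nonneg _
      rw [mul_right_comm (4*C+1)]
      apply mul_le_mul_of_nonneg_right _ (by positivity)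
      have h10 : 0 ≤ C * δ^2 := by positivity
      linarith
  rw [← Real.sqrt_sq hδ.le, ← Real.sqrt_mul (by positivity)]
  exact Real.abs_le_sqrt key

/-- `√(1-z²)` in the variable `t = -log z` -/
def Tf (t : ℝ) : ℝ := Real.sqrt (1 - Real.exp (-2*t))

/-- `w(z)` in the variable `t = -log z` -/
def wt (t : ℝ) : ℝ := t + Real.log (1 + Tf t) - Tf t

lemma Tf_nonneg (t : ℝ) : 0 ≤ Tf t := Real.sqrt_nonneg _

lemma Tf_arg_pos {t : ℝ} (ht : 0 < t) : 0 < 1 - Real.exp (-2*t) := by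
  have : Real.exp (-2*t) < 1 := Real.exp_lt_one_iff.2 (by linarith)
  linarith

lemma Tf_pos {t : ℝ} (ht : 0 < t) : 0 < Tf t := Real.sqrt_pos.2 (Tf_arg_pos ht)

lemma Tf_sq {t : ℝ} (ht : 0 ≤ t) : Tf t ^ 2 = 1 - Real.exp (-2*t) := by
  apply Real.sq_sqrt
  have : Real.exp (-2*t) ≤ 1 := Real.exp_le_one_iff.2 (by linarith)
  linarith

lemma Tf_lt_one {t : ℝ} (ht : 0 ≤ t) : Tf t < 1 := by
  have := Tf_sq ht
  nlinarith [Tf_nonneg t, Real.exp_pos (-2*t)]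

lemma Tf_zero : Tf 0 = 0 := by simp [Tf]
lemma wt_zero : wt 0 = 0 := by simp [wt, Tf_zero]

lemma Tf_cont : Continuous Tf := by unfold Tf; fun_prop

lemma wt_cont : Continuous wt := by
  unfold wt
  have h := Tf_cont
  refine (continuous_id.add (Continuous.log (by fun_prop) ?_)).sub h
  intro x
  have := Tf_nonneg x
  positivity

lemma Tf_deriv {t : ℝ} (ht : 0 < t) : HasDerivAt Tf ((1 - Tf t ^ 2) / Tf t) t := by
  have e0 : HasDerivAt (fun t => 1 - Real.exp (-2*t)) (2 * Real.exp (-2*t)) t := by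
    have := (((hasDerivAt_id t).const_mul (-2:ℝ)).exp).const_sub 1
    refine this.congr_deriv ?_
    simp only [id]; ring
  have := e0.sqrt (Tf_arg_pos ht).ne'
  refine this.congr_deriv ?_
  rw [Tf_sq ht.le]
  change 2 * Real.exp (-2*t) / (2 * Tf t) = _
  have := Tf_pos ht
  field_simp
  ring

lemma wt_deriv {t : ℝ} (ht : 0 < t) : HasDerivAt wt (Tf t) t := by
  have hT := Tf_pos ht
  have h1 := ((hasDerivAt_id t).add (((Tf_deriv ht).const_add 1).log (by positivity))).sub (Tf_deriv ht)
  refine h1.congr_deriv ?_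
  field_simp
  ring

lemma wfun_eq_wt {t : ℝ} (ht : 0 ≤ t) : wfun (Real.exp (-t)) = wt t := by
  unfold wfun wt
  have h1 : (Real.exp (-t))^2 = Real.exp (-2*t) := by
    rw [← Real.exp_nat_mul]; push_cast; ring_nf
  have h2 : Real.sqrt (1 / Real.exp (-t) ^ 2 - 1) = Real.exp t * Tf t := by
    rw [h1]
    have : 1 / Real.exp (-2*t) - 1 = (Real.exp t * Tf t)^2 := by
      rw [mul_pow, Tf_sq ht, mul_sub, mul_one, ← Real.exp_nat_mul, ← Real.exp_add, one_div, ← Real.exp_neg]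
      push_cast
      ring_nf
      simp [add_comm, sub_eq_add_neg]
    rw [this, Real.sqrt_sq (mul_nonneg (Real.exp_pos t).le (Tf_nonneg t))]
  have h3 : 1 / Real.exp (-t) = Real.exp t := by rw [one_div, ← Real.exp_neg, neg_neg]
  rw [h2, h1, h3]
  have h4 : Real.exp t + Real.exp t * Tf t = Real.exp t * (1 + Tf t) := by ring
  have := Tf_nonneg t
  rw [h4, Real.log_mul (Real.exp_pos t).ne' (by positivity), Real.log_exp]
  rfl

lemma Tpoly_deriv {t : ℝ} (ht : 0 < t) (n : ℕ) :
    HasDerivAt (fun t => Tf t ^ (n+2)) ((n+2) * Tf t ^ n * (1 - Tf t^2)) t := by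
  have := (Tf_deriv ht).pow (n+2)
  refine this.congr_deriv ?_
  have := Tf_pos ht
  simp only [Nat.add_succ_sub_one]
  field_simp
  push_cast
  ring

lemma wt_lower {t : ℝ} (ht : 0 ≤ t) : Tf t ^ 3 / 3 + Tf t ^ 5 / 5 ≤ wt t := by
  have hm : MonotoneOn (fun t => wt t - (Tf t ^ 3 / 3 + Tf t ^ 5 / 5)) (Set.Ici 0) := by
    have hd : ∀ x, 0 < x → HasDerivAt (fun t => wt t - (Tf t ^ 3 / 3 + Tf t ^ 5 / 5)) (Tf x ^ 5) x := by
      intro x hx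
      have := (wt_deriv hx).sub (((Tpoly_deriv hx 1).div_const 3).add ((Tpoly_deriv hx 3).div_const 5))
      refine this.congr_deriv ?_
      push_cast; ring
    apply monotoneOn_of_deriv_nonneg (convex_Ici 0)
    · have := Tf_cont; have := wt_cont; fun_prop
    · intro x hx; rw [interior_Ici] at hx
      exact (hd x hx).differentiableAt.differentiableWithinAt
    · intro x hx; rw [interior_Ici] at hx
      rw [(hd x hx).deriv]; have := Tf_nonneg x; positivity
  have := hm (Set.mem_Ici.2 le_rfl) (Set.mem_Ici.2 ht) ht
  simp only [wt_zero, Tf_zero] at this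
  norm_num at this
  linarith

lemma wt_upper {t : ℝ} (ht : 0 ≤ t) (ht2 : t ≤ 2) :
    wt t ≤ Tf t ^ 3 / 3 + Tf t ^ 5 / 5 + Real.exp 4 / 7 * Tf t ^ 7 := by
  have hm : AntitoneOn (fun t => wt t - (Tf t ^ 3 / 3 + Tf t ^ 5 / 5 + Real.exp 4 / 7 * Tf t ^ 7)) (Set.Icc 0 2) := by
    have hd : ∀ x, 0 < x → HasDerivAt (fun t => wt t - (Tf t ^ 3 / 3 + Tf t ^ 5 / 5 + Real.exp 4 / 7 * Tf t ^ 7))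
        (Tf x ^ 5 * (1 - Real.exp 4 * (1 - Tf x ^ 2))) x := by
      intro x hx
      have := (wt_deriv hx).sub ((((Tpoly_deriv hx 1).div_const 3).add ((Tpoly_deriv hx 3).div_const 5)).add
        ((Tpoly_deriv hx 5).const_mul (Real.exp 4 / 7)))
      refine this.congr_deriv ?_
      push_cast; ring
    apply antitoneOn_of_deriv_nonpos (convex_Icc 0 2)
    · have := Tf_cont; have := wt_cont; fun_prop
    · intro x hx; rw [interior_Icc] at hx
      exact (hd x hx.1).differentiableAt.differentiableWithinAt
    · intro x hx; rw [interior_Icc] at hx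
      rw [(hd x hx.1).deriv]; have := Tf_nonneg x
      apply mul_nonpos_of_nonneg_of_nonpos (by positivity)
      rw [Tf_sq hx.1.le]
      have : Real.exp 4 * (1 - (1 - Real.exp (-2*x))) = Real.exp (4 - 2*x) := by
        rw [sub_sub_cancel, ← Real.exp_add]; ring_nf
      rw [this]
      have := Real.one_le_exp (x := 4 - 2*x) (by linarith [hx.2])
      linarith
  have := hm ⟨le_rfl, by norm_num⟩ ⟨ht, ht2⟩ ht
  simp only [wt_zero, Tf_zero] at this
  norm_num at this
  linarith

lemma wt_pos {t : ℝ} (ht : 0 < t) : 0 < wt t := by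
  have := wt_lower ht.le
  have h := Tf_pos ht
  have : 0 < Tf t ^ 3 / 3 + Tf t ^ 5 / 5 := by positivity
  linarith

/-- `q = 3w/T³` -/
def qf (t : ℝ) : ℝ := 3 * wt t / Tf t ^ 3

lemma qf_bounds {t : ℝ} (ht : 0 < t) (ht2 : t ≤ 2) :
    ∃ e, 0 ≤ e ∧ e ≤ 3 * Real.exp 4 / 7 ∧ qf t = 1 + 3/5 * Tf t^2 + e * Tf t ^ 4 := by
  have hT := Tf_pos ht
  refine ⟨(qf t - (1 + 3/5 * Tf t^2)) / Tf t ^ 4, ?_, ?_, by field_simp; ring⟩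
  · apply div_nonneg _ (by positivity)
    unfold qf
    have := wt_lower ht.le
    rw [sub_nonneg, le_div_iff₀ (by positivity)]
    linarith
  · rw [div_le_iff₀ (by positivity), sub_le_iff_le_add]
    unfold qf
    rw [div_le_iff₀ (by positivity)]
    have := wt_upper ht.le ht2
    linarith

/-- the perturbation term -/
def Rf (t : ℝ) : ℝ := (5 / (4 * Tf t ^ 4) - 3 / (2 * Tf t ^2) + 1/4) - 5 * Tf t ^ 2 / (36 * wt t ^ 2)

lemma Rf_bound : ∃ B, 0 ≤ B ∧ ∀ t, 0 < t → t ≤ 2 → |Rf t| ≤ B := by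
  set M := 3 * Real.exp 4 / 7 with hM
  have hMp : 0 ≤ M := by positivity
  refine ⟨5/4*(10 + 10 * M + M^2 * 1 * 3) + 1, by positivity, ?_⟩
  intro t ht ht2
  have hT := Tf_pos ht
  have hT1 := Tf_lt_one ht.le
  obtain ⟨e, he0, heM, hq⟩ := qf_bounds ht ht2
  have hw : wt t = Tf t ^ 3 * qf t / 3 := by unfold qf; field_simp
  have hqp : 1 ≤ qf t := by rw [hq]; have : 0 ≤ 3/5 * Tf t^2 + e * Tf t ^ 4 := by positivity
                            linarith
  set T := Tf t with hTd
  set q := qf t with hqd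
  set b := T^2 with hb
  have hb0 : 0 ≤ b := by positivity
  have hb1 : b ≤ 1 := by rw [hb]; nlinarith
  have hq' : q = 1 + 3/5*b + e * b^2 := by rw [hq, hb]; ring
  have hR : Rf t = 5/4 * (((1 - 6/5*b) * q^2 - 1) / b^2) / q^2 + 1/4 := by
    unfold Rf
    rw [hw, ← hTd, hb]; field_simp; ring
  have hnum : ((1 - 6/5*b) * q^2 - 1) / b^2 = (-(27/25) + 2*e) - 54/125*b - 6/5*e*b - 36/25 * e * b^2 + e^2*b^2 - 6/5*e^2*b^3 := by
    rw [hq']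
    have : b ≠ 0 := by rw [hb]; positivity
    field_simp; ring
  have e2 : e^2 ≤ M^2 := by gcongr
  have hnumb : |((1 - 6/5*b) * q^2 - 1) / b^2| ≤ 10 + 10 * M + M^2 * 1 * 3:= by
    rw [hnum]
    have hb2 : b^2 ≤ 1 := by nlinarith
    have hb3 : b^3 ≤ 1 := pow_le_one₀ hb0 hb1
    have hb30 : 0 ≤ b^3 := by positivity
    have f1 : 0 ≤ e*b := by positivity
    have f2 : e*b ≤ M := by nlinarith
    have f3 : 0 ≤ e*b^2 := by positivity
    have f4 : e*b^2 ≤ M := by nlinarith [sq_nonneg b]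
    have f5 : 0 ≤ e^2*b^2 := by positivity
    have f6 : e^2*b^2 ≤ M^2 := by nlinarith [sq_nonneg b, sq_nonneg e]
    have f7 : 0 ≤ e^2*b^3 := by positivity
    have f8 : e^2*b^3 ≤ M^2 := by nlinarith [sq_nonneg e]
    rw [abs_le]; constructor <;> linarith
  rw [hR]
  have g1 : |5/4 * (((1 - 6/5*b) * q^2 - 1) / b^2) / q^2| ≤ 5/4 * (10 + 10 * M + M^2 * 1 * 3) := by
    rw [abs_div, abs_of_pos (by positivity : 0 < q^2), abs_mul, abs_of_pos (by norm_num : (0:ℝ) < 5/4)]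
    rw [div_le_iff₀ (by positivity)]
    have : (1:ℝ) ≤ q^2 := one_le_pow₀ hqp
    calc _ ≤ 5/4 * (10 + 10 * M + M^2 * 1 * 3) := by gcongr
      _ = 5/4 * (10 + 10 * M + M^2 * 1 * 3) * 1 := by ring
      _ ≤ _ := by gcongr
  refine (abs_add_le _ _).trans ?_
  have : |(1/4:ℝ)| = 1/4 := by norm_num
  linarith

/-- coefficients of the Bessel series -/
def gc (μ : ℝ) (j : ℕ) : ℝ := (-1 : ℝ) ^ j / ((j.factorial : ℝ) * Real.Gamma ((j : ℝ) + μ))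

/-- reduced Bessel series -/
def Gs (μ y : ℝ) : ℝ := ∑' j : ℕ, gc μ j * y ^ j

lemma gamma_lower (μ : ℝ) (hμ : 0 < μ) : ∃ m, 0 < m ∧ ∀ j : ℕ, m ≤ Real.Gamma ((j : ℝ) + μ) := by
  refine ⟨min (Real.Gamma μ) (Real.Gamma (μ+1)), lt_min (Real.Gamma_pos_of_pos hμ) (Real.Gamma_pos_of_pos (by linarith)), ?_⟩
  intro j
  rcases j with _ | j
  · simp
  · refine (min_le_right _ _).trans ?_
    induction j with
    | zero => simp [add_comm]
    | succ k ih =>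
      have hk : (0:ℝ) ≤ k := Nat.cast_nonneg k
      have h1 : (((k+1+1 : ℕ) : ℝ) + μ) = (((k+1:ℕ):ℝ) + μ) + 1 := by push_cast; ring
      rw [h1, Real.Gamma_add_one (s := ((k+1:ℕ):ℝ) + μ) (by push_cast; positivity)]
      have h2 : 0 < Real.Gamma (((k+1:ℕ):ℝ) + μ) := Real.Gamma_pos_of_pos (by push_cast; positivity)
      have h3 : (1:ℝ) ≤ ((k+1:ℕ):ℝ) + μ := by push_cast; linarith
      nlinarith

lemma gc_bound (μ : ℝ) (hμ : 0 < μ) : ∃ C, 0 < C ∧ ∀ j : ℕ, |gc μ j| ≤ C / (j.factorial : ℝ) := by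
  obtain ⟨m, hm, h⟩ := gamma_lower μ hμ
  refine ⟨1/m, by positivity, ?_⟩
  intro j
  have hj := h j
  have hg : 0 < Real.Gamma ((j : ℝ) + μ) := hm.trans_le hj
  have hf : (0:ℝ) < j.factorial := by positivity
  unfold gc
  rw [abs_div, abs_pow, abs_neg, abs_one, one_pow, abs_of_pos (by positivity), div_div]
  apply one_div_le_one_div_of_le (by positivity)
  rw [mul_comm m]; gcongr

lemma gs_summable (μ : ℝ) (hμ : 0 < μ) (y : ℝ) : Summable (fun j : ℕ => gc μ j * y ^ j) := by
  obtain ⟨C, hC, h⟩ := gc_bound μ hμ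
  apply Summable.of_norm_bounded (g := fun j : ℕ => C * (|y|^j / (j.factorial : ℝ)))
  · exact (Real.summable_pow_div_factorial |y|).mul_left C
  · intro j
    rw [norm_mul, norm_pow, Real.norm_eq_abs, Real.norm_eq_abs]
    calc |gc μ j| * |y|^j ≤ C / (j.factorial : ℝ) * |y|^j := by gcongr; exact h j
      _ = _ := by ring

lemma gc_succ (μ : ℝ) (j : ℕ) : gc μ (j+1) * ((j+1 : ℕ) : ℝ) = - gc (μ+1) j := by
  unfold gc
  have h1 : (((j+1:ℕ):ℝ) + μ) = (j:ℝ) + (μ+1) := by push_cast; ring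
  rw [h1, pow_succ, Nat.factorial_succ]
  push_cast
  have : (j:ℝ)+1 ≠ 0 := by positivity
  have hf : (j.factorial:ℝ) ≠ 0 := by positivity
  by_cases hg : Real.Gamma ((j:ℝ) + (μ+1)) = 0
  · simp [hg]
  · field_simp

lemma gs_deriv (μ : ℝ) (hμ : 0 < μ) (y : ℝ) : HasDerivAt (Gs μ) (- Gs (μ+1) y) y := by
  obtain ⟨C, hC, h⟩ := gc_bound μ hμ
  set r := |y| + 1 with hr
  have hrp : 0 < r := by positivity
  have key : HasDerivAt (fun z => ∑' j : ℕ, gc μ j * z ^ j) (∑' j : ℕ, gc μ j * (j * y^(j-1))) y := by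
    apply hasDerivAt_tsum_of_isPreconnected (u := fun j : ℕ => C * ((j:ℝ) / (j.factorial : ℝ) * r^(j-1)))
      (t := Metric.ball (0:ℝ) r) (g := fun j z => gc μ j * z ^ j) (g' := fun j z => gc μ j * (j * z^(j-1))) (y₀ := 0)
    · apply Summable.mul_left
      rw [← summable_nat_add_iff 1]
      refine (Real.summable_pow_div_factorial r).congr ?_
      intro j
      rw [Nat.factorial_succ]
      push_cast
      have : (j:ℝ)+1 ≠ 0 := by positivity
      have hf : (j.factorial:ℝ) ≠ 0 := by positivity
      field_simp
    · exact Metric.isOpen_ball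
    · exact (convex_ball (0:ℝ) r).isPreconnected
    · intro n z _
      exact (hasDerivAt_pow n z).const_mul _
    · intro n z hz
      rw [Metric.mem_ball, dist_zero_right, Real.norm_eq_abs] at hz
      rw [norm_mul, norm_mul, norm_pow, Real.norm_eq_abs, Real.norm_eq_abs, Real.norm_eq_abs, Nat.abs_cast]
      calc |gc μ n| * (n * |z|^(n-1)) ≤ C / (n.factorial : ℝ) * (n * r^(n-1)) := by
            gcongr; exact h n
        _ = _ := by ring
    · exact Metric.mem_ball_self hrp
    · exact gs_summable μ hμ 0
    · rw [Metric.mem_ball, dist_zero_right, Real.norm_eq_abs]; linarith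
  have heq : (∑' j : ℕ, gc μ j * (j * y^(j-1))) = - Gs (μ+1) y := by
    have hs : Summable (fun j : ℕ => gc μ j * (j * y^(j-1))) := by
      rw [← summable_nat_add_iff 1]
      refine ((gs_summable (μ+1) (by linarith) y).neg).congr ?_
      intro j
      rw [Nat.add_sub_cancel, ← mul_assoc, gc_succ]; ring
    rw [hs.tsum_eq_zero_add, Gs, ← tsum_neg]
    simp only [Nat.cast_zero, zero_mul, mul_zero, zero_add]
    congr 1
    ext j
    rw [Nat.add_sub_cancel, ← mul_assoc, gc_succ]; ring
  rw [← heq]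
  exact key

lemma gs_rec (μ : ℝ) (hμ : 0 < μ) (y : ℝ) : Gs μ y = μ * Gs (μ+1) y - y * Gs (μ+2) y := by
  have hs2 := gs_summable (μ+2) (by linarith) y
  have hs1 := gs_summable (μ+1) (by linarith) y
  have hs0 := gs_summable μ hμ y
  have h2 : y * Gs (μ+2) y = - ∑' j : ℕ, (j:ℝ) * (gc (μ+1) j * y^j) := by
    have hs : Summable (fun j : ℕ => (j:ℝ) * (gc (μ+1) j * y^j)) := by
      rw [← summable_nat_add_iff 1]
      refine ((hs2.mul_left y).neg).congr ?_
      intro j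
      have := gc_succ (μ+1) j
      have e : μ+1+1 = μ+2 := by ring
      rw [e] at this
      rw [show (((j+1:ℕ):ℝ) * (gc (μ+1) (j+1) * y^(j+1))) = (gc (μ+1) (j+1) * ((j+1:ℕ):ℝ)) * y^(j+1) by ring, this]
      ring
    rw [hs.tsum_eq_zero_add, Gs, ← tsum_mul_left]
    simp only [Nat.cast_zero, zero_mul, zero_add]
    rw [← tsum_neg]
    congr 1
    ext j
    have := gc_succ (μ+1) j
    have e : μ+1+1 = μ+2 := by ring
    rw [e] at this
    rw [show (((j+1:ℕ):ℝ) * (gc (μ+1) (j+1) * y^(j+1))) = (gc (μ+1) (j+1) * ((j+1:ℕ):ℝ)) * y^(j+1) by ring, this]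
    ring
  have hterm : ∀ j : ℕ, gc μ j * y^j = μ * (gc (μ+1) j * y^j) + (j:ℝ) * (gc (μ+1) j * y^j) := by
    intro j
    have hp : (0:ℝ) < (j:ℝ) + μ := by positivity
    have : gc μ j = (j + μ) * gc (μ+1) j := by
      unfold gc
      have e : (j:ℝ) + (μ+1) = ((j:ℝ)+μ) + 1 := by ring
      rw [e, Real.Gamma_add_one hp.ne']
      have := Real.Gamma_pos_of_pos hp
      field_simp
    rw [this]; ring
  have hs : Summable (fun j : ℕ => (j:ℝ) * (gc (μ+1) j * y^j)) := by
    refine (hs0.sub (hs1.mul_left μ)).congr ?_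
    intro j
    rw [hterm j]; ring
  rw [h2, sub_neg_eq_add]
  unfold Gs
  rw [← tsum_mul_left, ← (hs1.mul_left μ).tsum_add hs]
  exact tsum_congr hterm

lemma gs_zero (μ : ℝ) : Gs μ 0 = 1 / Real.Gamma μ := by
  unfold Gs
  rw [tsum_eq_single 0]
  · simp [gc]
  · intro j hj; simp [hj]

lemma gs_cont (μ : ℝ) (hμ : 0 < μ) : Continuous (Gs μ) :=
  continuous_iff_continuousAt.2 fun y => (gs_deriv μ hμ y).continuousAt

lemma Jbes_eq (ν x : ℝ) (hx : 0 < x) : Jbes ν x = (x/2)^ν * Gs (ν+1) (x^2/4) := by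
  unfold Jbes Gs
  rw [← tsum_mul_left]
  congr 1
  ext j
  have h2 : 0 < x/2 := by positivity
  rw [Real.rpow_add h2]
  have : (x/2)^(2*(j:ℝ)) = (x^2/4)^j := by
    rw [Real.rpow_mul h2.le, Real.rpow_natCast]
    norm_num
    ring
  rw [this]
  unfold gc
  rw [add_assoc]; ring

/-- derivative of the Bessel function -/
def J1 (ν x : ℝ) : ℝ := ν / x * Jbes ν x - (x/2)^(ν+1) * Gs (ν+2) (x^2/4)

lemma sq4_deriv (x : ℝ) : HasDerivAt (fun x : ℝ => x^2/4) (x/2) x := by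
  have := (hasDerivAt_pow 2 x).div_const 4
  refine this.congr_deriv ?_
  push_cast; ring

lemma half_rpow_deriv (ν x : ℝ) (hx : 0 < x) : HasDerivAt (fun x : ℝ => (x/2)^ν) (ν / x * (x/2)^ν) x := by
  have := ((hasDerivAt_id x).div_const 2).rpow_const (p := ν) (Or.inl (by simp; positivity))
  refine this.congr_deriv ?_
  have h2 : 0 < x/2 := by positivity
  simp only [id]
  rw [Real.rpow_sub h2, Real.rpow_one]
  field_simp

lemma Jbes_deriv (ν x : ℝ) (hν : 0 < ν + 1) (hx : 0 < x) : HasDerivAt (Jbes ν) (J1 ν x) x := by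
  have h1 : HasDerivAt (fun x : ℝ => (x/2)^ν * Gs (ν+1) (x^2/4)) (J1 ν x) x := by
    have h := (half_rpow_deriv ν x hx).mul ((gs_deriv (ν+1) hν (x^2/4)).comp x (sq4_deriv x))
    refine h.congr_deriv ?_
    unfold J1
    rw [Jbes_eq ν x hx, Real.rpow_add (by positivity), Real.rpow_one]
    simp only [Function.comp]
    rw [show ν+1+1 = ν+2 by ring]
    ring
  apply h1.congr_of_eventuallyEq
  filter_upwards [lt_mem_nhds hx] with z hz
  exact Jbes_eq ν z hz

lemma J1_deriv (ν x : ℝ) (hν : 0 < ν + 1) (hx : 0 < x) :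
    HasDerivAt (J1 ν) (- J1 ν x / x - (1 - ν^2/x^2) * Jbes ν x) x := by
  have a1 := (hasDerivAt_inv hx.ne').const_mul ν
  have a2 := a1.mul (Jbes_deriv ν x hν hx)
  have a3 := (half_rpow_deriv (ν+1) x hx).mul ((gs_deriv (ν+2) (by linarith) (x^2/4)).comp x (sq4_deriv x))
  have a4 := a2.sub a3
  have hfun : J1 ν = fun x => (ν * x⁻¹) * Jbes ν x - (x/2)^(ν+1) * Gs (ν+2) (x^2/4) := by
    ext y; unfold J1; rw [div_eq_mul_inv]
  rw [hfun]
  refine a4.congr_deriv ?_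
  simp only [id, Function.comp]
  have hr := gs_rec (ν+1) hν (x^2/4)
  rw [show ν+1+1 = ν+2 by ring, show ν+1+2 = ν+3 by ring] at hr
  rw [show ν+2+1 = ν+3 by ring]
  have hJ := Jbes_eq ν x hx
  unfold J1
  rw [hJ, Real.rpow_add (by positivity : 0 < x/2), Real.rpow_one]
  rw [hr]
  field_simp
  ring

/-- Wronskian constant -/
def Hw (y : ℝ) : ℝ := -(2/3) * Gs (4/3) y * Gs (2/3) y + 2 * y * (- Gs (4/3) y * Gs (5/3) y + Gs (7/3) y * Gs (2/3) y)

lemma Hw_deriv (y : ℝ) : HasDerivAt Hw 0 y := by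
  have d4 := gs_deriv (4/3) (by norm_num) y
  have d2 := gs_deriv (2/3) (by norm_num) y
  have d5 := gs_deriv (5/3) (by norm_num) y
  have d7 := gs_deriv (7/3) (by norm_num) y
  have r4 := gs_rec (4/3) (by norm_num) y
  have r2 := gs_rec (2/3) (by norm_num) y
  norm_num at d4 d2 d5 d7 r4 r2
  have h := ((d4.const_mul (-(2/3))).mul d2).add (((hasDerivAt_id y).const_mul 2).mul ((d4.neg.mul d5).add (d7.mul d2)))
  refine h.congr_deriv ?_
  simp only [id, Pi.neg_apply, Pi.add_apply, Pi.mul_apply]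
  linear_combination (-2 * Gs (2/3) y) * r4 + (2 * Gs (4/3) y) * r2

lemma Hw_eq (y : ℝ) : Hw y = - Real.sqrt 3 / Real.pi := by
  have h : Hw y = Hw 0 := is_const_of_deriv_eq_zero (fun x => (Hw_deriv x).differentiableAt) (fun x => (Hw_deriv x).deriv) y 0
  rw [h]
  unfold Hw
  rw [gs_zero, gs_zero]
  have h1 : Real.Gamma (4/3) = 1/3 * Real.Gamma (1/3) := by
    rw [← Real.Gamma_add_one (by norm_num)]; norm_num
  have h2 := Real.Gamma_mul_Gamma_one_sub (1/3)
  rw [show (1:ℝ) - 1/3 = 2/3 by norm_num, show Real.pi * (1/3) = Real.pi/3 by ring, Real.sin_pi_div_three] at h2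
  have g1 : 0 < Real.Gamma (1/3) := Real.Gamma_pos_of_pos (by norm_num)
  have g2 : 0 < Real.Gamma (2/3) := Real.Gamma_pos_of_pos (by norm_num)
  have hs : Real.sqrt 3 * Real.sqrt 3 = 3 := Real.mul_self_sqrt (by norm_num)
  have hs0 : 0 < Real.sqrt 3 := by positivity
  have hpi := Real.pi_pos
  rw [h1]
  field_simp at h2 ⊢
  nlinarith

lemma wronskian (x : ℝ) (hx : 0 < x) :
    x * (Jbes (1/3) x * J1 (-(1/3)) x - J1 (1/3) x * Jbes (-(1/3)) x) = - Real.sqrt 3 / Real.pi := by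
  rw [← Hw_eq (x^2/4)]
  unfold J1 Hw
  rw [Jbes_eq _ x hx, Jbes_eq _ x hx]
  norm_num
  have h2 : 0 < x/2 := by positivity
  have e1 : (x/2)^((4:ℝ)/3) = (x/2)^((1:ℝ)/3) * (x/2) := by
    rw [← Real.rpow_add_one h2.ne']; norm_num
  have e2 : (x/2)^((2:ℝ)/3) = (x/2)^(-(1:ℝ)/3) * (x/2) := by
    rw [← Real.rpow_add_one h2.ne']; norm_num
  have e3 : (x/2)^((1:ℝ)/3) * (x/2)^(-(1:ℝ)/3) = 1 := by
    rw [← Real.rpow_add h2]; norm_num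
  have e4 : (-(1/3) : ℝ) = -1/3 := by norm_num
  try rw [e4]
  rw [e1, e2]
  set a := (x/2)^((1:ℝ)/3)
  set b := (x/2)^(-(1:ℝ)/3)
  generalize Gs (4/3) (x^2/4) = g4
  generalize Gs (2/3) (x^2/4) = g2
  generalize Gs (5/3) (x^2/4) = g5
  generalize Gs (7/3) (x^2/4) = g7
  calc _ = (a*b) * (-(2 / 3 * g4 * g2) + 2 * (x ^ 2 / 4) * (-(g4 * g5) + g7 * g2)) := by
        field_simp; ring
    _ = _ := by rw [e3, one_mul]

/-- derivative of `Y_{1/3}` -/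
def Y1 (x : ℝ) : ℝ :=
  (J1 (1/3) x * Real.cos (Real.pi / 3) - J1 (-(1/3)) x) / Real.sin (Real.pi / 3)

lemma Y13_deriv (x : ℝ) (hx : 0 < x) : HasDerivAt Y13 (Y1 x) x := by
  exact (((Jbes_deriv (1/3) x (by norm_num) hx).mul_const _).sub (Jbes_deriv (-(1/3)) x (by norm_num) hx)).div_const _

lemma wronskian_Y (x : ℝ) (hx : 0 < x) :
    Jbes (1/3) x * Y1 x - J1 (1/3) x * Y13 x = 2 / (Real.pi * x) := by
  have h := wronskian x hx
  unfold Y1 Y13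
  rw [Real.sin_pi_div_three, Real.cos_pi_div_three]
  have hs0 : 0 < Real.sqrt 3 := by positivity
  have hpi := Real.pi_pos
  generalize Jbes (1/3) x = a at *
  generalize Jbes (-(1/3)) x = b at *
  generalize J1 (1/3) x = c at *
  generalize J1 (-(1/3)) x = d at *
  have h' : a * d - c * b = - Real.sqrt 3 / (Real.pi * x) := by
    field_simp at h ⊢; linarith
  have : a * ((c * (1/2) - d) / (Real.sqrt 3 / 2)) - c * ((a * (1/2) - b) / (Real.sqrt 3/2)) = -(a*d - c*b) * 2/ Real.sqrt 3 := by
    field_simp; ring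
  rw [this, h']
  field_simp

lemma Msq_pos (x : ℝ) (hx : 0 < x) : 0 < Jbes (1/3) x ^ 2 + Y13 x ^ 2 := by
  have h := wronskian_Y x hx
  have hpi := Real.pi_pos
  have h2 : 0 < 2 / (Real.pi * x) := by positivity
  by_contra hn
  have h3 : Jbes (1/3) x ^ 2 + Y13 x ^ 2 = 0 := le_antisymm (not_lt.1 hn) (by positivity)
  have a : Jbes (1/3) x = 0 := by nlinarith [sq_nonneg (Jbes (1/3) x), sq_nonneg (Y13 x)]
  have b : Y13 x = 0 := by nlinarith [sq_nonneg (Jbes (1/3) x), sq_nonneg (Y13 x)]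
  rw [a, b] at h
  simp only [zero_mul, mul_zero, sub_zero] at h
  linarith

lemma M13_pos (x : ℝ) (hx : 0 < x) : 0 < M13 x := Real.sqrt_pos.2 (Msq_pos x hx)

lemma M13_sq (x : ℝ) (hx : 0 < x) : M13 x ^ 2 = Jbes (1/3) x ^ 2 + Y13 x ^ 2 := Real.sq_sqrt (Msq_pos x hx).le

lemma M13_deriv (x : ℝ) (hx : 0 < x) :
    HasDerivAt M13 ((Jbes (1/3) x * J1 (1/3) x + Y13 x * Y1 x) / M13 x) x := by
  have h := (((Jbes_deriv (1/3) x (by norm_num) hx).pow 2).add ((Y13_deriv x hx).pow 2)).sqrt (Msq_pos x hx).ne'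
  refine h.congr_deriv ?_
  change _ / (2 * M13 x) = _
  have := M13_pos x hx
  field_simp
  push_cast
  ring

lemma theta_cont : ContinuousOn (fun t : ℝ => 2 / (Real.pi * t * M13 t ^ 2)) (Set.Ioi 0) := by
  intro x hx
  have hx' : 0 < x := hx
  have h1 := (M13_deriv x hx').continuousAt
  have h2 := M13_pos x hx'
  have h3 := Real.pi_pos
  apply ContinuousAt.continuousWithinAt
  apply ContinuousAt.div continuousAt_const (by fun_prop) (by positivity)

lemma exists_angle (a b : ℝ) (h : a^2 + b^2 = 1) : ∃ φ, a = Real.cos φ ∧ b = Real.sin φ := by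
  refine ⟨Complex.arg ⟨a, b⟩, ?_⟩
  have hn : ‖(⟨a, b⟩ : ℂ)‖ = 1 := by
    rw [Complex.norm_eq_sqrt_sq_add_sq]; simp [h]
  have h0 : (⟨a, b⟩ : ℂ) ≠ 0 := by
    intro h0; rw [h0] at hn; simp at hn
  constructor
  · rw [Complex.cos_arg h0, hn]; simp
  · rw [Complex.sin_arg, hn]; simp

lemma theta_exists : ∃ θ : ℝ → ℝ,
    (∀ t : ℝ, 0 < t → HasDerivAt θ (2 / (Real.pi * t * M13 t ^ 2)) t) ∧
    ∀ x, 0 < x → M13 x * Real.sin (θ x) = (Jbes (1/3) x + Jbes (-(1/3)) x) / Real.sqrt 3 := by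
  set θ₀ : ℝ → ℝ := fun t => ∫ s in (1:ℝ)..t, 2 / (Real.pi * s * M13 s ^ 2) with hθ₀
  have hd : ∀ t : ℝ, 0 < t → HasDerivAt θ₀ (2 / (Real.pi * t * M13 t ^ 2)) t := by
    intro t ht
    apply intervalIntegral.integral_hasDerivAt_right
    · apply ContinuousOn.intervalIntegrable
      apply theta_cont.mono
      intro s hs
      rw [Set.mem_uIcc] at hs
      rcases hs with hs | hs
      · exact lt_of_lt_of_le one_pos hs.1
      · exact lt_of_lt_of_le ht hs.1
    · exact theta_cont.stronglyMeasurableAtFilter isOpen_Ioi t ht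
    · exact theta_cont.continuousAt (isOpen_Ioi.mem_nhds ht)
  have hd' : ∀ t : ℝ, 0 < t → HasDerivAt θ₀ ((Jbes (1/3) t * Y1 t - J1 (1/3) t * Y13 t) / M13 t ^ 2) t := by
    intro t ht
    refine (hd t ht).congr_deriv ?_
    rw [wronskian_Y t ht, div_div]
  set cc : ℝ → ℝ := fun x => (Jbes (1/3) x * Real.cos (θ₀ x) + Y13 x * Real.sin (θ₀ x)) / M13 x with hcc
  set ss : ℝ → ℝ := fun x => (Y13 x * Real.cos (θ₀ x) - Jbes (1/3) x * Real.sin (θ₀ x)) / M13 x with hss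
  have hcd : ∀ x, 0 < x → HasDerivAt cc 0 x := by
    intro x hx
    have hM := M13_pos x hx
    have h1 := (((Jbes_deriv (1/3) x (by norm_num) hx).mul (hd' x hx).cos).add ((Y13_deriv x hx).mul (hd' x hx).sin)).div (M13_deriv x hx) hM.ne'
    refine h1.congr_deriv ?_
    simp only [Pi.add_apply, Pi.mul_apply]
    have hM2 := M13_sq x hx
    generalize Jbes (1/3) x = a at *
    generalize Y13 x = b at *
    generalize M13 x = m at *
    field_simp
    linear_combination (Real.cos (θ₀ x) * J1 (1/3) x + Real.sin (θ₀ x) * Y1 x) * hM2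
  have hsd : ∀ x, 0 < x → HasDerivAt ss 0 x := by
    intro x hx
    have hM := M13_pos x hx
    have h1 := (((Y13_deriv x hx).mul (hd' x hx).cos).sub ((Jbes_deriv (1/3) x (by norm_num) hx).mul (hd' x hx).sin)).div (M13_deriv x hx) hM.ne'
    refine h1.congr_deriv ?_
    simp only [Pi.sub_apply, Pi.mul_apply]
    have hM2 := M13_sq x hx
    generalize Jbes (1/3) x = a at *
    generalize Y13 x = b at *
    generalize M13 x = m at *
    field_simp
    linear_combination (Real.cos (θ₀ x) * Y1 x - Real.sin (θ₀ x) * J1 (1/3) x) * hM2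
  have hconst : ∀ (f : ℝ → ℝ), (∀ x, 0 < x → HasDerivAt f 0 x) → ∀ x, 0 < x → f x = f 1 := by
    intro f hf x hx
    apply (convex_Ioi (0:ℝ)).is_const_of_fderivWithin_eq_zero (𝕜 := ℝ) (f := f)
    · intro y hy; exact (hf y hy).differentiableAt.differentiableWithinAt
    · intro y hy
      rw [fderivWithin_of_isOpen isOpen_Ioi hy]
      have := (hf y hy).hasFDerivAt.fderiv
      rw [this]; ext; simp
    · exact hx
    · exact Set.mem_Ioi.2 one_pos
  have h1 : cc 1 ^ 2 + ss 1 ^ 2 = 1 := by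
    have hM := M13_pos 1 one_pos
    have hM2 := M13_sq 1 one_pos
    simp only [hcc, hss]
    rw [div_pow, div_pow, ← add_div, div_eq_one_iff_eq (by positivity), hM2]
    linear_combination (Jbes (1/3) 1 ^ 2 + Y13 1 ^ 2) * Real.sin_sq_add_cos_sq (θ₀ 1)
  obtain ⟨φ, hφ1, hφ2⟩ := exists_angle _ _ h1
  refine ⟨fun x => θ₀ x + (φ + (Real.pi / 2 + Real.pi / 6)), ?_, ?_⟩
  · intro t ht
    exact (hd t ht).add_const _
  · intro x hx
    have hM := M13_pos x hx
    have e1 := hconst cc hcd x hx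
    have e2 := hconst ss hsd x hx
    rw [hφ1] at e1
    rw [hφ2] at e2
    have f1 : Jbes (1/3) x * Real.cos (θ₀ x) + Y13 x * Real.sin (θ₀ x) = M13 x * Real.cos φ := by
      rw [← e1]; simp only [hcc]; field_simp
    have f2 : Y13 x * Real.cos (θ₀ x) - Jbes (1/3) x * Real.sin (θ₀ x) = M13 x * Real.sin φ := by
      rw [← e2]; simp only [hss]; field_simp
    have g1 : M13 x * Real.cos (θ₀ x + φ) = Jbes (1/3) x := by
      rw [Real.cos_add]
      linear_combination (-Real.cos (θ₀ x)) * f1 + Real.sin (θ₀ x) * f2 + Jbes (1/3) x * Real.sin_sq_add_cos_sq (θ₀ x)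
    have g2 : M13 x * Real.sin (θ₀ x + φ) = Y13 x := by
      rw [Real.sin_add]
      linear_combination (-Real.sin (θ₀ x)) * f1 - Real.cos (θ₀ x) * f2 + Y13 x * Real.sin_sq_add_cos_sq (θ₀ x)
    have hsin : Real.sin (θ₀ x + (φ + (Real.pi / 2 + Real.pi / 6))) = Real.cos (θ₀ x + φ) * (Real.sqrt 3 / 2) - Real.sin (θ₀ x + φ) * (1/2) := by
      rw [show θ₀ x + (φ + (Real.pi / 2 + Real.pi / 6)) = (θ₀ x + φ + Real.pi/6) + Real.pi/2 by ring,
        Real.sin_add_pi_div_two, Real.cos_add, Real.cos_pi_div_six, Real.sin_pi_div_six]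
    simp only
    rw [hsin, mul_sub, ← mul_assoc, ← mul_assoc, g1, g2]
    unfold Y13
    rw [Real.sin_pi_div_three, Real.cos_pi_div_three]
    have hs : Real.sqrt 3 ^ 2 = 3 := Real.sq_sqrt (by norm_num)
    have hs0 : 0 < Real.sqrt 3 := by positivity
    field_simp
    rw [hs]; ring

/-- prefactor -/
def Pf (t : ℝ) : ℝ := Real.sqrt (wt t) / Real.sqrt (Tf t)
/-- log-derivative of the prefactor -/
def Sf (t : ℝ) : ℝ := Tf t / (2 * wt t) - (1 - Tf t ^ 2) / (2 * Tf t ^ 2)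
/-- sum of Bessel functions -/
def fB (x : ℝ) : ℝ := Jbes (1/3) x + Jbes (-(1/3)) x
/-- its derivative -/
def fB1 (x : ℝ) : ℝ := J1 (1/3) x + J1 (-(1/3)) x
/-- the main term -/
def Am (v t : ℝ) : ℝ := Real.pi / Real.sqrt 3 * (Pf t * fB (v * wt t))
/-- its derivative -/
def Am1 (v t : ℝ) : ℝ := Real.pi / Real.sqrt 3 * (Pf t * (Sf t * fB (v * wt t) + v * Tf t * fB1 (v * wt t)))

lemma fB_deriv (x : ℝ) (hx : 0 < x) : HasDerivAt fB (fB1 x) x :=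
  (Jbes_deriv (1/3) x (by norm_num) hx).add (Jbes_deriv (-(1/3)) x (by norm_num) hx)

lemma fB1_deriv (x : ℝ) (hx : 0 < x) : HasDerivAt fB1 (-fB1 x / x - (1 - 1/(9*x^2)) * fB x) x := by
  refine ((J1_deriv (1/3) x (by norm_num) hx).add (J1_deriv (-(1/3)) x (by norm_num) hx)).congr_deriv ?_
  unfold fB fB1
  field_simp
  ring

lemma Pf_deriv {t : ℝ} (ht : 0 < t) : HasDerivAt Pf (Pf t * Sf t) t := by
  have hT := Tf_pos ht
  have hw := wt_pos ht
  have h := ((wt_deriv ht).sqrt hw.ne').div ((Tf_deriv ht).sqrt hT.ne') (Real.sqrt_pos.2 hT).ne'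
  refine h.congr_deriv ?_
  unfold Pf Sf
  have e1 := Real.sq_sqrt hw.le
  have e2 := Real.sq_sqrt hT.le
  have p1 := Real.sqrt_pos.2 hw
  have p2 := Real.sqrt_pos.2 hT
  generalize Real.sqrt (wt t) = a at *
  generalize Real.sqrt (Tf t) = b at *
  rw [← e1, ← e2]
  field_simp

lemma Sf_deriv {t : ℝ} (ht : 0 < t) : HasDerivAt Sf ((1 - Tf t^2)/(2 * Tf t * wt t) - Tf t^2/(2*wt t^2) + (1 - Tf t^2)/Tf t^4) t := by
  have hT := Tf_pos ht
  have hw := wt_pos ht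
  have h1 := (Tf_deriv ht).div ((wt_deriv ht).const_mul 2) (by positivity)
  have h2 := (((Tf_deriv ht).pow 2).const_sub 1).div (((Tf_deriv ht).pow 2).const_mul 2) (by simp only [Pi.pow_apply]; positivity)
  refine (h1.sub h2).congr_deriv ?_
  simp only [Pi.pow_apply]
  field_simp
  ring

lemma vwt_deriv (v : ℝ) {t : ℝ} (ht : 0 < t) : HasDerivAt (fun t => v * wt t) (v * Tf t) t :=
  (wt_deriv ht).const_mul v

lemma Am_deriv {v t : ℝ} (hv : 0 < v) (ht : 0 < t) : HasDerivAt (Am v) (Am1 v t) t := by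
  have hw := wt_pos ht
  have h := ((Pf_deriv ht).mul ((fB_deriv (v * wt t) (by positivity)).comp t (vwt_deriv v ht))).const_mul (Real.pi / Real.sqrt 3)
  refine h.congr_deriv ?_
  unfold Am1
  simp only [Function.comp]
  ring

lemma Am1_deriv {v t : ℝ} (hv : 0 < v) (ht : 0 < t) :
    HasDerivAt (Am1 v) (-(v^2 * (1 - Real.exp (-2*t))) * Am v t + Rf t * Am v t) t := by
  have hT := Tf_pos ht
  have hw := wt_pos ht
  have hf := (fB_deriv (v * wt t) (by positivity)).comp t (vwt_deriv v ht)
  have hf1 := (fB1_deriv (v * wt t) (by positivity)).comp t (vwt_deriv v ht)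
  have h := ((Pf_deriv ht).mul (((Sf_deriv ht).mul hf).add (((Tf_deriv ht).const_mul v).mul hf1))).const_mul (Real.pi / Real.sqrt 3)
  refine h.congr_deriv ?_
  rw [← Tf_sq ht.le]
  unfold Am Rf
  simp only [Function.comp, Pi.add_apply, Pi.mul_apply]
  unfold Sf
  generalize Real.pi / Real.sqrt 3 = k
  generalize fB (v * wt t) = f
  generalize fB1 (v * wt t) = g
  generalize Pf t = P
  field_simp
  ring

/-- `b = (q/3)^{1/6}` -/
def bq (t : ℝ) : ℝ := (qf t / 3) ^ ((1:ℝ)/6)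

lemma qf_pos {t : ℝ} (ht : 0 < t) : 0 < qf t := by
  have hT := Tf_pos ht
  have hw := wt_pos ht
  unfold qf; positivity

lemma bq_pos {t : ℝ} (ht : 0 < t) : 0 < bq t := by
  have := qf_pos ht
  unfold bq; positivity

lemma bq_pow {t : ℝ} (ht : 0 < t) : bq t ^ 6 = qf t / 3 := by
  have := qf_pos ht
  unfold bq
  rw [← Real.rpow_natCast, ← Real.rpow_mul (by positivity)]
  norm_num

lemma wt_bq {t : ℝ} (ht : 0 < t) : wt t = Tf t ^ 3 * bq t ^ 6 := by
  have hT := Tf_pos ht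
  rw [bq_pow ht]; unfold qf; field_simp

lemma Pf_bq {t : ℝ} (ht : 0 < t) : Pf t = Tf t * bq t ^ 3 := by
  have hT := Tf_pos ht
  have hb := bq_pos ht
  unfold Pf
  rw [← Real.sqrt_div' _ hT.le, Real.sqrt_eq_iff_mul_self_eq (by have := wt_pos ht; positivity) (by positivity), wt_bq ht]
  field_simp

lemma cube_rpow {c : ℝ} (hc : 0 < c) (p : ℝ) (n : ℤ) (h : 3 * p = n) : (c^3)^p = c ^ n := by
  rw [← Real.rpow_natCast, ← Real.rpow_mul hc.le, ← Real.rpow_intCast, ← h]; norm_num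

/-- the coefficient tending to `1/5` -/
def Ef (t : ℝ) : ℝ := (1/qf t - 1 + Tf t ^ 2)/(2 * Tf t^2)

lemma Am_eq {a t : ℝ} (ha : 0 < a) (ht : 0 < t) :
    Am (2 * a^3) t = Real.pi / Real.sqrt 3 * (a * Tf t ^ 2 * bq t ^ 5 * Gs (4/3) ((2 * a^3 * wt t)^2/4)
      + a⁻¹ * bq t * Gs (2/3) ((2 * a^3 * wt t)^2/4)) := by
  have hT := Tf_pos ht
  have hw := wt_pos ht
  have hb := bq_pos ht
  have hx : 0 < 2 * a^3 * wt t := by positivity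
  have hc : 2 * a^3 * wt t / 2 = (a * Tf t * bq t^2)^3 := by rw [wt_bq ht]; ring
  have hcp : 0 < a * Tf t * bq t^2 := by positivity
  unfold Am fB
  rw [Jbes_eq _ _ hx, Jbes_eq _ _ hx, hc, cube_rpow hcp (1/3) 1 (by norm_num), cube_rpow hcp (-(1/3)) (-1) (by norm_num), Pf_bq ht]
  norm_num
  generalize Gs (4/3) _ = G1
  generalize Gs (2/3) _ = G2
  generalize Tf t = T at *
  generalize bq t = b at *
  field_simp

lemma Am1_eq {a t : ℝ} (ha : 0 < a) (ht : 0 < t) :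
    Am1 (2 * a^3) t = Real.pi / Real.sqrt 3 * (
      a⁻¹ * bq t * Ef t * Gs (2/3) ((2 * a^3 * wt t)^2/4)
      + a * bq t^5 * (5/(6 * bq t ^ 6) - 1/2 + Tf t^2/2) * Gs (4/3) ((2 * a^3 * wt t)^2/4)
      - 2 * a^3 * Tf t^2 * bq t^3 * ((a * Tf t * bq t^2)^4 * Gs (7/3) ((2 * a^3 * wt t)^2/4)
        + (a * Tf t * bq t^2)^2 * Gs (5/3) ((2 * a^3 * wt t)^2/4))) := by
  have hT := Tf_pos ht
  have hw := wt_pos ht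
  have hb := bq_pos ht
  have hx : 0 < 2 * a^3 * wt t := by positivity
  have hc : 2 * a^3 * wt t / 2 = (a * Tf t * bq t^2)^3 := by rw [wt_bq ht]; ring
  have hcp : 0 < a * Tf t * bq t^2 := by positivity
  have hq : qf t = 3 * bq t^6 := by rw [bq_pow ht]; ring
  unfold Am1 fB fB1 J1 Sf Ef
  rw [Jbes_eq _ _ hx, Jbes_eq _ _ hx, hc, cube_rpow hcp (1/3) 1 (by norm_num), cube_rpow hcp (-(1/3)) (-1) (by norm_num),
    cube_rpow hcp (1/3+1) 4 (by norm_num), cube_rpow hcp (-(1/3)+1) 2 (by norm_num), Pf_bq ht, hq]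
  norm_num
  generalize Gs (4/3) _ = G1
  generalize Gs (2/3) _ = G2
  generalize Gs (5/3) _ = G3
  generalize Gs (7/3) _ = G4
  rw [wt_bq ht]
  generalize Tf t = T at *
  generalize bq t = b at *
  generalize Real.pi / Real.sqrt 3 = k
  have e4 : (a * T * b^2) ^ (4:ℤ) = (a*T*b^2)^4 := by norm_cast
  have e2 : (a * T * b^2) ^ (2:ℤ) = (a*T*b^2)^2 := by norm_cast
  try rw [e4]
  try rw [e2]
  field_simp
  ring

lemma Tf_tendsto : Tendsto Tf (nhdsWithin 0 (Set.Ioi 0)) (nhds 0) := by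
  have := (Tf_cont.tendsto 0).mono_left (nhdsWithin_le_nhds (s := Set.Ioi 0))
  rwa [Tf_zero] at this

lemma wt_tendsto : Tendsto wt (nhdsWithin 0 (Set.Ioi 0)) (nhds 0) := by
  have := (wt_cont.tendsto 0).mono_left (nhdsWithin_le_nhds (s := Set.Ioi 0))
  rwa [wt_zero] at this

lemma ev2 : ∀ᶠ t : ℝ in nhdsWithin 0 (Set.Ioi 0), 0 < t ∧ t ≤ 2 := by
  filter_upwards [Ioc_mem_nhdsGT (show (0:ℝ) < 2 by norm_num)] with t ht using ht

lemma qf_tendsto : Tendsto qf (nhdsWithin 0 (Set.Ioi 0)) (nhds 1) := by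
  have hT := Tf_tendsto
  have hup : Tendsto (fun t => 1 + 3/5 * Tf t^2 + (3 * Real.exp 4/7) * Tf t^4) (nhdsWithin 0 (Set.Ioi 0)) (nhds 1) := by
    have := (((hT.pow 2).const_mul (3/5)).const_add 1).add ((hT.pow 4).const_mul (3 * Real.exp 4/7))
    simpa using this
  refine tendsto_of_tendsto_of_tendsto_of_le_of_le' tendsto_const_nhds hup ?_ ?_
  · filter_upwards [ev2] with t ht
    obtain ⟨e, he, -, h⟩ := qf_bounds ht.1 ht.2
    rw [h]
    have : 0 ≤ 3/5 * Tf t^2 + e * Tf t^4 := by positivity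
    linarith
  · filter_upwards [ev2] with t ht
    obtain ⟨e, he, he2, h⟩ := qf_bounds ht.1 ht.2
    rw [h]
    gcongr

lemma Ef_tendsto : Tendsto Ef (nhdsWithin 0 (Set.Ioi 0)) (nhds (1/5)) := by
  have hT := Tf_tendsto
  rw [tendsto_iff_norm_sub_tendsto_zero]
  have hup : Tendsto (fun t => (1 + 2 * (3 * Real.exp 4/7)) * Tf t^2) (nhdsWithin 0 (Set.Ioi 0)) (nhds 0) := by
    have := (hT.pow 2).const_mul (1 + 2 * (3 * Real.exp 4/7))
    simpa using this
  refine tendsto_of_tendsto_of_tendsto_of_le_of_le' tendsto_const_nhds hup ?_ ?_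
  · filter_upwards with t using norm_nonneg _
  · filter_upwards [ev2] with t ht
    obtain ⟨e, he, he2, h⟩ := qf_bounds ht.1 ht.2
    have hq := qf_pos ht.1
    have hTp := Tf_pos ht.1
    have hT1 := Tf_lt_one ht.1.le
    have hq1 : 1 ≤ qf t := by
      rw [h]
      have : 0 ≤ 3/5 * Tf t^2 + e * Tf t^4 := by positivity
      linarith
    generalize (3 * Real.exp 4 / 7) = M at *
    have hE : Ef t - 1/5 = Tf t^2 * ((9/25 + 3/5*e*Tf t^2 - e)/(2 * qf t)) := by
      unfold Ef
      have : e * Tf t^4 = qf t - 1 - 3/5 * Tf t^2 := by linarith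
      field_simp
      linear_combination (-125 + 75 * Tf t^2) * h
    rw [Real.norm_eq_abs, hE, abs_mul, abs_of_pos (by positivity), mul_comm]
    gcongr
    rw [abs_div, abs_of_pos (show 0 < 2 * qf t by positivity), div_le_iff₀ (by positivity)]
    have hTT : Tf t^2 ≤ 1 := by nlinarith
    have : |9/25 + 3/5*e*Tf t^2 - e| ≤ 1 + 2*M := by
      rw [abs_le]; constructor <;> nlinarith [mul_le_mul_of_nonneg_left hTT he, mul_nonneg he (sq_nonneg (Tf t))]
    nlinarith

lemma bq_tendsto : Tendsto bq (nhdsWithin 0 (Set.Ioi 0)) (nhds ((1/3) ^ ((1:ℝ)/6))) := by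
  exact (qf_tendsto.div_const 3).rpow_const (Or.inl (by norm_num))

lemma Gs_tendsto (a : ℝ) (μ : ℝ) (hμ : 0 < μ) :
    Tendsto (fun t => Gs μ ((2 * a^3 * wt t)^2/4)) (nhdsWithin 0 (Set.Ioi 0)) (nhds (1/Real.Gamma μ)) := by
  rw [← gs_zero]
  refine ((gs_cont μ hμ).tendsto 0).comp ?_
  have := ((wt_tendsto.const_mul (2 * a^3)).pow 2).div_const 4
  simpa using this

lemma Am_tendsto {a : ℝ} (ha : 0 < a) : Tendsto (Am (2*a^3)) (nhdsWithin 0 (Set.Ioi 0))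
    (nhds (Real.pi / Real.sqrt 3 * (a⁻¹ * (1/3) ^ ((1:ℝ)/6) * (1/Real.Gamma (2/3))))) := by
  have h := (((((Tf_tendsto.pow 2).const_mul a).mul (bq_tendsto.pow 5)).mul (Gs_tendsto a (4/3) (by norm_num))).add
    ((bq_tendsto.const_mul a⁻¹).mul (Gs_tendsto a (2/3) (by norm_num)))).const_mul (Real.pi / Real.sqrt 3)
  refine (Tendsto.congr' ?_ h).trans_eq ?_
  · filter_upwards [ev2] with t ht
    rw [Am_eq ha ht.1]
  · congr 1; ring

lemma b0_pow : ((1/3:ℝ) ^ ((1:ℝ)/6))^6 = 1/3 := by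
  rw [← Real.rpow_natCast, ← Real.rpow_mul (by positivity)]
  norm_num

lemma Am1_tendsto {a : ℝ} (ha : 0 < a) : Tendsto (Am1 (2*a^3)) (nhdsWithin 0 (Set.Ioi 0))
    (nhds (Real.pi / Real.sqrt 3 * (a⁻¹ * (1/3) ^ ((1:ℝ)/6) * (1/Real.Gamma (2/3)) / 5
      + 2 * a * ((1/3) ^ ((1:ℝ)/6))^5 * (1/Real.Gamma (4/3))))) := by
  have g2 := Gs_tendsto a (2/3) (by norm_num)
  have g4 := Gs_tendsto a (4/3) (by norm_num)
  have g5 := Gs_tendsto a (5/3) (by norm_num)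
  have g7 := Gs_tendsto a (7/3) (by norm_num)
  have hb := bq_tendsto
  have hT := Tf_tendsto
  have k1 := ((hb.const_mul a⁻¹).mul Ef_tendsto).mul g2
  have k2a : Tendsto (fun t => 5/(6 * bq t ^ 6) - 1/2 + Tf t^2/2) (nhdsWithin 0 (Set.Ioi 0)) (nhds 2) := by
    have := (((tendsto_const_nhds (x := (5:ℝ))).div ((hb.pow 6).const_mul 6) (by rw [b0_pow]; norm_num)).sub_const (1/2)).add ((hT.pow 2).div_const 2)
    rw [b0_pow] at this
    norm_num at this
    simpa using this
  have k2 := ((((hb.pow 5).const_mul a)).mul k2a).mul g4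
  have c := (hT.const_mul a).mul (hb.pow 2)
  have k3 := (((hT.pow 2).const_mul (2 * a^3)).mul (hb.pow 3)).mul (((c.pow 4).mul g7).add ((c.pow 2).mul g5))
  have h := ((k1.add k2).sub k3).const_mul (Real.pi / Real.sqrt 3)
  refine (Tendsto.congr' ?_ h).trans_eq ?_
  · filter_upwards [ev2] with t ht
    rw [Am1_eq ha ht.1]
  · congr 1; ring

/-- moments of the K-Bessel integral -/
def Kn (n : ℕ) (v u : ℝ) : ℝ :=
  ∫ s in Set.Ioi (0 : ℝ), Real.cosh s ^ n * Real.exp (-u * Real.cosh s) * Real.cos (v * s)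

lemma Kbes_eq_Kn (v u : ℝ) : Kbes v u = Kn 0 v u := by
  unfold Kbes Kn; simp

lemma cosh_exp_bound (n : ℕ) {u : ℝ} (hu : 0 < u) (s : ℝ) :
    Real.cosh s ^ n * Real.exp (-u * Real.cosh s) ≤ (2 * ((n+1).factorial : ℝ) / u^(n+1)) * Real.exp (-s) := by
  have h1 := Real.pow_div_factorial_le_exp (x := u * Real.cosh s) (by have := Real.cosh_pos s; positivity) (n+1)
  have hc := Real.cosh_pos s
  have h2 : Real.exp s ≤ 2 * Real.cosh s := by
    rw [Real.cosh_eq]; have := Real.exp_pos (-s); linarith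
  have he := Real.exp_pos s
  have hf : (0:ℝ) < ((n+1).factorial : ℝ) := by positivity
  rw [neg_mul, Real.exp_neg, Real.exp_neg]
  rw [div_le_iff₀ hf] at h1
  have hE := Real.exp_pos (u * Real.cosh s)
  rw [← div_eq_mul_inv, ← div_eq_mul_inv, div_div, div_le_div_iff₀ hE (by positivity)]
  calc Real.cosh s ^ n * (u ^ (n+1) * Real.exp s) ≤ Real.cosh s ^ n * (u ^ (n+1) * (2 * Real.cosh s)) := by gcongr
    _ = 2 * (u * Real.cosh s)^(n+1) := by ring
    _ ≤ 2 * (Real.exp (u * Real.cosh s) * ((n+1).factorial : ℝ)) := by gcongr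
    _ = _ := by ring

lemma Kn_integrable (n : ℕ) (v : ℝ) {u : ℝ} (hu : 0 < u) :
    MeasureTheory.IntegrableOn (fun s => Real.cosh s ^ n * Real.exp (-u * Real.cosh s) * Real.cos (v * s)) (Set.Ioi 0) := by
  refine ((integrableOn_exp_neg_Ioi 0).const_mul (2 * ((n+1).factorial : ℝ) / u^(n+1))).mono' ?_ ?_
  · exact Continuous.aestronglyMeasurable (by have := Real.continuous_cosh; have := Real.continuous_cos; fun_prop)
  · refine Filter.Eventually.of_forall fun s => ?_
    have hc := Real.cosh_pos s
    rw [Real.norm_eq_abs, abs_mul, abs_of_pos (by positivity)]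
    calc _ ≤ Real.cosh s ^ n * Real.exp (-u * Real.cosh s) * 1 := by
          gcongr; exact Real.abs_cos_le_one _
      _ ≤ _ := by rw [mul_one]; exact cosh_exp_bound n hu s

lemma Kn_deriv (n : ℕ) (v : ℝ) {u : ℝ} (hu : 0 < u) : HasDerivAt (Kn n v) (- Kn (n+1) v u) u := by
  have hmem : Set.Ioi (u/2) ∈ nhds u := Ioi_mem_nhds (by linarith)
  have key := hasDerivAt_integral_of_dominated_loc_of_deriv_le (μ := MeasureTheory.volume.restrict (Set.Ioi (0:ℝ)))
    (F := fun u s => Real.cosh s ^ n * Real.exp (-u * Real.cosh s) * Real.cos (v * s))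
    (F' := fun u s => -(Real.cosh s ^ (n+1) * Real.exp (-u * Real.cosh s) * Real.cos (v * s)))
    (bound := fun s => (2 * ((n+1+1).factorial : ℝ) / (u/2)^(n+1+1)) * Real.exp (-s)) (x₀ := u) hmem
    (Filter.Eventually.of_forall fun x => Continuous.aestronglyMeasurable (by have := Real.continuous_cosh; have := Real.continuous_cos; fun_prop))
    (Kn_integrable n v hu)
    (Continuous.aestronglyMeasurable (by have := Real.continuous_cosh; have := Real.continuous_cos; fun_prop))
    (Filter.Eventually.of_forall fun s x hx => ?_)
    ((integrableOn_exp_neg_Ioi 0).const_mul _)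
    (Filter.Eventually.of_forall fun s x hx => ?_)
  · have := key.2
    rw [MeasureTheory.integral_neg] at this
    exact this
  · have hx' : u/2 < x := hx
    have hc := Real.cosh_pos s
    rw [norm_neg, Real.norm_eq_abs, abs_mul, abs_of_pos (by positivity)]
    calc _ ≤ Real.cosh s ^ (n+1) * Real.exp (-(u/2) * Real.cosh s) * 1 := by
          gcongr; exact Real.abs_cos_le_one _
      _ ≤ _ := by rw [mul_one]; exact cosh_exp_bound (n+1) (by positivity) s
  · have := (((((hasDerivAt_id x).neg).mul_const (Real.cosh s)).exp).const_mul (Real.cosh s ^ n)).mul_const (Real.cos (v*s))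
    refine this.congr_deriv ?_
    simp only [Pi.neg_apply, id]
    ring

lemma Kn_ode (v : ℝ) {u : ℝ} (hu : 0 < u) : u^2 * Kn 2 v u - u * Kn 1 v u + (v^2 - u^2) * Kn 0 v u = 0 := by
  have i0 := Kn_integrable 0 v hu
  have i1 := Kn_integrable 1 v hu
  have i2 := Kn_integrable 2 v hu
  have h21 : MeasureTheory.IntegrableOn (fun s => u^2 * (Real.cosh s ^ 2 * Real.exp (-u * Real.cosh s) * Real.cos (v * s))
      - u * (Real.cosh s ^ 1 * Real.exp (-u * Real.cosh s) * Real.cos (v * s))) (Set.Ioi 0) :=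
    ((i2.const_mul (u^2)).sub (i1.const_mul u)).congr (Filter.Eventually.of_forall fun s => by simp only [Pi.sub_apply])
  have hIntg : MeasureTheory.IntegrableOn (fun s => u^2 * (Real.cosh s ^ 2 * Real.exp (-u * Real.cosh s) * Real.cos (v * s))
      - u * (Real.cosh s ^ 1 * Real.exp (-u * Real.cosh s) * Real.cos (v * s))
      + (v^2-u^2) * (Real.cosh s ^ 0 * Real.exp (-u * Real.cosh s) * Real.cos (v * s))) (Set.Ioi 0) :=
    (h21.add (i0.const_mul (v^2-u^2))).congr (Filter.Eventually.of_forall fun s => by simp only [Pi.add_apply])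
  have key := MeasureTheory.integral_Ioi_of_hasDerivAt_of_tendsto' (a := (0:ℝ)) (m := (0:ℝ))
    (f := fun s => -u * Real.sinh s * Real.exp (-u * Real.cosh s) * Real.cos (v*s) + v * Real.exp (-u * Real.cosh s) * Real.sin (v*s))
    (f' := fun s => u^2 * (Real.cosh s ^ 2 * Real.exp (-u * Real.cosh s) * Real.cos (v * s))
      - u * (Real.cosh s ^ 1 * Real.exp (-u * Real.cosh s) * Real.cos (v * s))
      + (v^2-u^2) * (Real.cosh s ^ 0 * Real.exp (-u * Real.cosh s) * Real.cos (v * s))) ?_ hIntg ?_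
  · rw [MeasureTheory.integral_add h21 (i0.const_mul (v^2-u^2)),
      MeasureTheory.integral_sub (i2.const_mul (u^2)) (i1.const_mul u)] at key
    simp only [MeasureTheory.integral_const_mul] at key
    unfold Kn
    rw [key]; simp
  · intro x _
    have hE : HasDerivAt (fun s => Real.exp (-u * Real.cosh s)) (Real.exp (-u * Real.cosh x) * (-u * Real.sinh x)) x :=
      ((Real.hasDerivAt_cosh x).const_mul (-u)).exp
    have hv : HasDerivAt (fun s : ℝ => v * s) v x := by simpa using (hasDerivAt_id x).const_mul v
    have hC := hv.cos
    have hS := hv.sin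
    have := ((((Real.hasDerivAt_sinh x).const_mul (-u)).mul hE).mul hC).add ((hE.const_mul v).mul hS)
    refine this.congr_deriv ?_
    simp only [Pi.mul_apply]
    have := Real.cosh_sq x
    rw [show Real.cosh x ^ 2 = Real.sinh x ^2 + 1 from this]
    ring
  · have hlim : Tendsto (fun s : ℝ => (u * (2 * ((1+1).factorial : ℝ) / u^(1+1)) + |v| * (2 * ((0+1).factorial : ℝ) / u^(0+1))) * Real.exp (-s)) atTop (nhds 0) := by
      have := (Real.tendsto_exp_neg_atTop_nhds_zero).const_mul (u * (2 * ((1+1).factorial : ℝ) / u^(1+1)) + |v| * (2 * ((0+1).factorial : ℝ) / u^(0+1)))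
      simpa using this
    refine squeeze_zero_norm (fun s => ?_) hlim
    have b1 := cosh_exp_bound 1 hu s
    have b0 := cosh_exp_bound 0 hu s
    have hsh : |Real.sinh s| ≤ Real.cosh s := by
      rw [abs_le]; constructor
      · have := Real.exp_pos s; rw [Real.sinh_eq, Real.cosh_eq]; linarith
      · exact (Real.sinh_lt_cosh s).le
    have hE := Real.exp_pos (-u * Real.cosh s)
    refine (norm_add_le _ _).trans ?_
    rw [add_mul]
    refine add_le_add ?_ ?_
    · rw [Real.norm_eq_abs, abs_mul, abs_mul, abs_mul, abs_neg, abs_of_pos hu, abs_of_pos hE]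
      calc _ ≤ u * Real.cosh s * Real.exp (-u * Real.cosh s) * 1 := by
            have := Real.cosh_pos s
            gcongr; exact Real.abs_cos_le_one _
        _ = u * (Real.cosh s ^ 1 * Real.exp (-u * Real.cosh s)) := by ring
        _ ≤ u * (2 * ((1+1).factorial : ℝ) / u^(1+1) * Real.exp (-s)) := by gcongr
        _ = _ := by ring
    · rw [Real.norm_eq_abs, abs_mul, abs_mul, abs_of_pos hE]
      calc _ ≤ |v| * Real.exp (-u * Real.cosh s) * 1 := by
            gcongr; exact Real.abs_sin_le_one _
        _ = |v| * (Real.cosh s ^ 0 * Real.exp (-u * Real.cosh s)) := by ring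
        _ ≤ |v| * (2 * ((0+1).factorial : ℝ) / u^(0+1) * Real.exp (-s)) := by gcongr
        _ = _ := by ring

/-- rescaled K-Bessel function in the variable `t` -/
def Wm (v t : ℝ) : ℝ := Real.exp (Real.pi * v / 2) * Kn 0 v (v * Real.exp (-t))
/-- its derivative -/
def Wm1 (v t : ℝ) : ℝ := Real.exp (Real.pi * v / 2) * (v * Real.exp (-t) * Kn 1 v (v * Real.exp (-t)))

lemma vexp_deriv (v t : ℝ) : HasDerivAt (fun t => v * Real.exp (-t)) (-(v * Real.exp (-t))) t := by
  have := (((hasDerivAt_id t).neg).exp).const_mul v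
  refine this.congr_deriv ?_
  simp

lemma Wm_deriv {v : ℝ} (hv : 0 < v) (t : ℝ) : HasDerivAt (Wm v) (Wm1 v t) t := by
  have h := ((Kn_deriv 0 v (u := v * Real.exp (-t)) (by positivity)).comp t (vexp_deriv v t)).const_mul (Real.exp (Real.pi * v / 2))
  refine h.congr_deriv ?_
  unfold Wm1; simp only [zero_add]; ring

lemma Wm1_deriv {v : ℝ} (hv : 0 < v) (t : ℝ) :
    HasDerivAt (Wm1 v) (-(v^2 * (1 - Real.exp (-2*t))) * Wm v t) t := by
  have h := ((vexp_deriv v t).mul ((Kn_deriv 1 v (u := v * Real.exp (-t)) (by positivity)).comp t (vexp_deriv v t))).const_mul (Real.exp (Real.pi * v / 2))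
  refine h.congr_deriv ?_
  have ho := Kn_ode v (u := v * Real.exp (-t)) (by positivity)
  have he : Real.exp (-2*t) = Real.exp (-t) ^ 2 := by
    rw [← Real.exp_nat_mul]; push_cast; ring_nf
  unfold Wm
  rw [he]
  simp only [Function.comp]
  linear_combination Real.exp (Real.pi * v / 2) * ho

lemma Wm_tendsto {v : ℝ} (hv : 0 < v) : Tendsto (Wm v) (nhdsWithin 0 (Set.Ioi 0)) (nhds (Wm v 0)) :=
  ((Wm_deriv hv 0).continuousAt.tendsto).mono_left nhdsWithin_le_nhds

lemma Wm1_tendsto {v : ℝ} (hv : 0 < v) : Tendsto (Wm1 v) (nhdsWithin 0 (Set.Ioi 0)) (nhds (Wm1 v 0)) :=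
  ((Wm1_deriv hv 0).continuousAt.tendsto).mono_left nhdsWithin_le_nhds

/-- direction of the ray -/
def om : ℂ := ⟨Real.sqrt 3 / 2, -(1/2)⟩

lemma om_sq : om ^ 2 = ⟨1/2, -(Real.sqrt 3 / 2)⟩ := by
  have h3 : Real.sqrt 3 * Real.sqrt 3 = 3 := Real.mul_self_sqrt (by norm_num)
  rw [pow_two]
  apply Complex.ext
  · simp only [om, Complex.mul_re]; linarith
  · simp only [om, Complex.mul_im]; ring

lemma om_cube : om ^ 3 = -I := by
  have h3 : Real.sqrt 3 * Real.sqrt 3 = 3 := Real.mul_self_sqrt (by norm_num)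
  rw [pow_succ, om_sq]
  apply Complex.ext
  · simp only [om, Complex.mul_re, Complex.neg_re, Complex.I_re]; ring
  · simp only [om, Complex.mul_im, Complex.neg_im, Complex.I_im]; linarith

lemma om_norm : ‖om‖ = 1 := by
  have h3 : Real.sqrt 3 * Real.sqrt 3 = 3 := Real.mul_self_sqrt (by norm_num)
  rw [Complex.norm_eq_sqrt_sq_add_sq]
  simp only [om]
  rw [Real.sqrt_eq_one]; nlinarith

lemma line_deriv {Φ F : ℂ → ℂ} (h : ∀ z, HasDerivAt Φ (F z) z) (p d : ℂ) (t : ℝ) :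
    HasDerivAt (fun t : ℝ => (Φ (p + t * d)).re) ((F (p + t * d) * d).re) t := by
  have h1 : HasDerivAt (fun z : ℂ => p + z * d) d (t : ℂ) := by
    simpa using ((hasDerivAt_id (t : ℂ)).mul_const d).const_add p
  have h2 := ((h (p + t * d)).comp (t : ℂ) h1).comp_ofReal
  exact (Complex.reCLM.hasFDerivAt.comp_hasDerivAt t h2)

/-- the integrand -/
def Fc (n : ℕ) (v : ℝ) (z : ℂ) : ℂ := Complex.cosh z ^ n * Complex.exp (v * (Real.pi / 2 - Complex.cosh z + I * z))

lemma Fc_diff (n : ℕ) (v : ℝ) : Differentiable ℂ (Fc n v) := by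
  unfold Fc
  have := Complex.differentiable_cosh
  fun_prop

lemma contour (n : ℕ) (v : ℝ) :
    ∫ t in (0:ℝ)..(Real.pi * Real.sqrt 3 / 2), (Fc n v t).re =
    ∫ r in (0:ℝ)..Real.pi, (Fc n v (I * (Real.pi/2) + r * om) * om).re := by
  obtain ⟨Φ, hΦ⟩ := (Fc_diff n v).isExactOn_univ
  have hΦ' : ∀ z, HasDerivAt Φ (Fc n v z) z := fun z => hΦ z (Set.mem_univ z)
  have hcont := (Fc_diff n v).continuous
  have e1 := intervalIntegral.integral_eq_sub_of_hasDerivAt (a := 0) (b := Real.pi * Real.sqrt 3 / 2)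
    (fun t _ => line_deriv hΦ' 0 1 t) (Continuous.intervalIntegrable (Complex.continuous_re.comp (by fun_prop)) _ _)
  have e2 := intervalIntegral.integral_eq_sub_of_hasDerivAt (a := 0) (b := Real.pi)
    (fun t _ => line_deriv hΦ' (I * (Real.pi/2)) om t) (Continuous.intervalIntegrable (Complex.continuous_re.comp (by fun_prop)) _ _)
  have e3 : (Φ (I * (Real.pi/2))).re = (Φ 0).re := by
    have hz : ∀ t : ℝ, HasDerivAt (fun t : ℝ => (Φ (0 + t * I)).re) 0 t := by
      intro t
      refine (line_deriv hΦ' 0 I t).congr_deriv ?_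
      have : Fc n v (0 + t * I) = ((Real.cos t ^ n * Real.exp (v * (Real.pi/2 - Real.cos t - t)) : ℝ) : ℂ) := by
        unfold Fc
        rw [zero_add, Complex.cosh_mul_I]
        push_cast
        congr 3
        have := Complex.I_mul_I
        linear_combination (t:ℂ) * this
      rw [this, Complex.re_ofReal_mul]; simp
    have := is_const_of_deriv_eq_zero (fun t => (hz t).differentiableAt) (fun t => (hz t).deriv) (Real.pi/2) 0
    simp only [Complex.ofReal_div, Complex.ofReal_zero] at this
    simp at this
    rw [mul_comm]; exact this
  simp only [zero_add, mul_one] at e1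
  rw [e1, e2]
  have hend : I * (Real.pi/2 : ℂ) + (Real.pi : ℂ) * om = ((Real.pi * Real.sqrt 3 / 2 : ℝ) : ℂ) := by
    apply Complex.ext
    · simp [om]; ring
    · simp [om]; ring
  rw [hend]
  simp only [Complex.ofReal_zero, zero_mul, add_zero]
  rw [e3]

lemma Fc_real (n : ℕ) (v t : ℝ) : (Fc n v t).re = Real.exp (Real.pi * v / 2) * (Real.cosh t ^ n * Real.exp (-v * Real.cosh t) * Real.cos (v * t)) := by
  have : Fc n v t = ((Real.cosh t ^ n : ℝ) : ℂ) * Complex.exp (((v * (Real.pi/2 - Real.cosh t) : ℝ) : ℂ) + ((v * t : ℝ) : ℂ) * I) := by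
    unfold Fc; push_cast; congr 2; ring
  rw [this, Complex.re_ofReal_mul, Complex.exp_add, ← Complex.ofReal_exp, Complex.re_ofReal_mul, Complex.exp_ofReal_mul_I_re]
  rw [show v * (Real.pi/2 - Real.cosh t) = Real.pi * v / 2 + (-v * Real.cosh t) by ring, Real.exp_add]
  ring

lemma Fc_ray (n : ℕ) (v : ℝ) (s : ℂ) : Fc n v (I * (Real.pi/2) + s) = (I * Complex.sinh s)^n * Complex.exp (I * v * (s - Complex.sinh s)) := by
  have : Complex.cosh (I * (Real.pi/2) + s) = I * Complex.sinh s := by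
    rw [Complex.cosh_add, mul_comm I, Complex.cosh_mul_I, Complex.sinh_mul_I, Complex.cos_pi_div_two, Complex.sin_pi_div_two]
    ring
  unfold Fc
  rw [this]
  congr 2
  have := Complex.I_mul_I
  linear_combination (v * Real.pi / 2 : ℂ) * this

lemma fact_lower (k : ℕ) : (5040:ℝ) * 72^k ≤ ((2*(k+3)+1).factorial : ℝ) := by
  induction k with
  | zero => norm_num [Nat.factorial]
  | succ k ih =>
    have : (2*(k+1+3)+1).factorial = (2*k+9) * ((2*k+8) * (2*(k+3)+1).factorial) := by
      rw [show 2*(k+1+3)+1 = (2*k+8)+1 by ring, Nat.factorial_succ, show 2*k+8 = (2*(k+3)+1)+1 by ring, Nat.factorial_succ]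
      ring
    rw [this]
    push_cast
    have hk : (0:ℝ) ≤ k := Nat.cast_nonneg k
    have h72 : (72:ℝ) ≤ (2*k+9)*(2*k+8) := by nlinarith
    calc (5040:ℝ) * 72^(k+1) = 72 * (5040 * 72^k) := by ring
      _ ≤ ((2*k+9)*(2*k+8)) * ((2*(k+3)+1).factorial : ℝ) := by gcongr
      _ = _ := by ring

lemma sinh_rem (s : ℂ) (hs : ‖s‖^2 ≤ 10) : ‖Complex.sinh s - (s + s^3/6 + s^5/120)‖ ≤ ‖s‖^7/4300 := by
  have h := (hasSum_nat_add_iff' 3).2 (Complex.hasSum_sinh s)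
  have e : ∑ i ∈ range 3, s ^ (2*i+1) / ((2*i+1).factorial : ℂ) = s + s^3/6 + s^5/120 := by
    simp [Finset.sum_range_succ, Nat.factorial]; norm_num
  rw [e] at h
  rw [← h.tsum_eq]
  have hg : HasSum (fun k : ℕ => ‖s‖^7/5040 * (10/72:ℝ)^k) (‖s‖^7/5040 * (1 - 10/72)⁻¹) :=
    (hasSum_geometric_of_lt_one (by norm_num) (by norm_num)).mul_left _
  refine (tsum_of_norm_bounded hg ?_).trans ?_
  · intro k
    rw [norm_div, norm_pow, Complex.norm_natCast]
    have hf := fact_lower k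
    have h2 : (‖s‖^2)^k ≤ 10^k := by gcongr
    calc ‖s‖^(2*(k+3)+1) / ((2*(k+3)+1).factorial : ℝ) ≤ ‖s‖^(2*(k+3)+1) / (5040*72^k) := by gcongr
      _ = ‖s‖^7 * (‖s‖^2)^k / (5040 * 72^k) := by congr 1; rw [← pow_mul, ← pow_add]; congr 1; ring
      _ ≤ ‖s‖^7 * 10^k / (5040 * 72^k) := by gcongr
      _ = _ := by rw [div_pow]; field_simp
  · have : 0 ≤ ‖s‖^7 := by positivity
    rw [div_mul_eq_mul_div, div_le_div_iff₀ (by norm_num) (by norm_num)]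
    norm_num; linarith

lemma pi_sq_le : Real.pi^2 ≤ 10 := by
  have := Real.pi_lt_d2; have := Real.pi_pos; nlinarith

lemma ray_norm {r : ℝ} (hr : 0 ≤ r) : ‖(r:ℂ) * om‖ = r := by
  rw [norm_mul, om_norm, mul_one, Complex.norm_real, Real.norm_of_nonneg hr]

lemma om4 : om^4 = -I * om := by rw [pow_succ, om_cube]
lemma om5 : om^5 = -I * om^2 := by rw [show om^5 = om^3*om^2 by ring, om_cube]

lemma ray_exp {v r : ℝ} (hv : 0 < v) (hr : 0 ≤ r) (hr2 : r ≤ Real.pi) :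
    ‖Complex.exp (I * v * (r * om - Complex.sinh (r * om))) - Real.exp (-(v*r^3)/6) * (1 - v * r^5 / 120 * om^2)‖
      ≤ 3240 * r^4 * Real.exp (-(v*r^3)/40) := by
  have hr10 : r^2 ≤ 10 := (pow_le_pow_left₀ hr hr2 2).trans pi_sq_le
  have hn := ray_norm hr
  have hR := sinh_rem (r * om) (by rw [hn]; exact hr10)
  rw [hn] at hR
  set R := Complex.sinh (r * om) - (r * om + (r * om)^3/6 + (r*om)^5/120) with hRd
  set X : ℂ := -(v * r^5 / 120 * om^2) - I * v * R with hX
  have hexp : I * v * (r * om - Complex.sinh (r * om)) = ((-(v*r^3)/6 : ℝ) : ℂ) + X := by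
    have : Complex.sinh (r * om) = R + (r * om + (r * om)^3/6 + (r*om)^5/120) := by rw [hRd]; ring
    rw [this, hX]
    push_cast
    have i2 := Complex.I_mul_I
    have o3 := om_cube
    have o5 := om5
    have o3' : om^3 = -I := o3
    simp only [mul_pow, o3, o5]
    linear_combination ((v:ℂ) * r^3/6 + v * r^5/120 * om^2) * i2
  have hv0 := hv.le
  have hy0 : 0 ≤ v * r^3 := by positivity
  have hIR : ‖I * v * R‖ ≤ v * (r^7/4300) := by
    rw [norm_mul, norm_mul, Complex.norm_I, one_mul, Complex.norm_real, Real.norm_of_nonneg hv0]; gcongr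
  have hX0 : ‖(v * r^5 / 120 * om^2 : ℂ)‖ = v * r^5/120 := by
    have : (v * r^5 / 120 * om^2 : ℂ) = ((v * r^5/120 : ℝ) : ℂ) * om^2 := by push_cast; ring
    rw [this, norm_mul, norm_pow, om_norm, Complex.norm_real, Real.norm_of_nonneg (by positivity)]; ring
  have hXn : ‖X‖ ≤ v * r^5/120 + v * (r^7/4300) := by
    rw [hX]
    refine (norm_sub_le _ _).trans ?_
    rw [norm_neg, hX0]; gcongr
  have h5 : v * r^5 ≤ 10 * (v * r^3) := by
    calc v * r^5 = (v*r^3) * r^2 := by ring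
      _ ≤ (v * r^3) * 10 := by gcongr
      _ = _ := by ring
  have h7 : v * r^7 ≤ 10 * (v * r^5) := by
    calc v * r^7 = (v*r^5) * r^2 := by ring
      _ ≤ (v * r^5) * 10 := by gcongr
      _ = _ := by ring
  have hXa : ‖X‖ ≤ 0.11 * (v * r^3) := by
    refine hXn.trans ?_
    linarith
  have hXb : ‖X‖ ≤ v * r^5 := by
    refine hXn.trans ?_
    have : 0 ≤ v * r^5 := by positivity
    linarith
  have hE := Complex.norm_exp_sub_sum_le_norm_mul_exp X 2
  have hsum : ∑ m ∈ range 2, X^m / (m.factorial : ℂ) = 1 + X := by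
    simp [Finset.sum_range_succ]
  rw [hsum] at hE
  have hE2 : ‖Complex.exp X - (1 - v * r^5 / 120 * om^2)‖ ≤ (v * r^5)^2 * Real.exp (0.11 * (v*r^3)) + v * (r^7/4300) := by
    have : Complex.exp X - (1 - v * r^5 / 120 * om^2) = (Complex.exp X - (1 + X)) - I * v * R := by rw [hX]; ring
    rw [this]
    refine (norm_sub_le _ _).trans ?_
    refine add_le_add (hE.trans ?_) hIR
    gcongr
  have hy1 : v * r^3 ≤ 40 * Real.exp (v*r^3/40) := by
    have := Real.add_one_le_exp (v*r^3/40); linarith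
  have hy2 : (v * r^3)^2 ≤ 3200 * Real.exp (v*r^3/40) := by
    have := Real.pow_div_factorial_le_exp (x := v*r^3/40) (by positivity) 2
    norm_num [Nat.factorial] at this
    nlinarith
  have hee : (1:ℝ) ≤ Real.exp (0.11 * (v*r^3)) := Real.one_le_exp (by positivity)
  rw [hexp, Complex.exp_add, ← Complex.ofReal_exp, ← mul_sub, norm_mul, Complex.norm_real, Real.norm_of_nonneg (Real.exp_pos _).le]
  have hpos := Real.exp_pos (v*r^3/40)
  calc Real.exp (-(v*r^3)/6) * _ ≤ Real.exp (-(v*r^3)/6) * ((v * r^5)^2 * Real.exp (0.11 * (v*r^3)) + v * (r^7/4300)) := by gcongr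
    _ ≤ Real.exp (-(v*r^3)/6) * ((r^4 * (3200 * Real.exp (v*r^3/40)) + r^4 * (40 * Real.exp (v*r^3/40))) * Real.exp (0.11 * (v*r^3))) := by
        gcongr
        have a1 : (v*r^5)^2 ≤ r^4 * (3200 * Real.exp (v*r^3/40)) := by
          calc (v*r^5)^2 = r^4 * (v*r^3)^2 := by ring
            _ ≤ _ := by gcongr
        have a2 : v*(r^7/4300) ≤ r^4 * (40 * Real.exp (v*r^3/40)) * 1 := by
          calc v*(r^7/4300) = r^4 * (v*r^3)/4300 := by ring
            _ ≤ r^4 * (v*r^3) := by apply div_le_self (by positivity); norm_num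
            _ ≤ r^4 * (40 * Real.exp (v*r^3/40)) := by gcongr
            _ = _ := by ring
        rw [add_mul]
        refine add_le_add (by gcongr) (a2.trans (by gcongr))
    _ = 3240 * r^4 * Real.exp (-(v*r^3)/6 + v*r^3/40 + 0.11 * (v*r^3)) := by
        rw [Real.exp_add, Real.exp_add]; ring
    _ ≤ _ := by
        gcongr
        linarith

lemma om_re : om.re = Real.sqrt 3 / 2 := rfl

lemma ray0 {v r : ℝ} (hv : 0 < v) (hr : 0 ≤ r) (hr2 : r ≤ Real.pi) :
    |(Fc 0 v (I * (Real.pi/2) + r * om) * om).re - Real.sqrt 3/2 * Real.exp (-(v*r^3)/6)|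
      ≤ 3240 * r^4 * Real.exp (-(v*r^3)/40) := by
  have h := ray_exp hv hr hr2
  rw [Fc_ray, pow_zero, one_mul]
  set E := Complex.exp (I * v * (r * om - Complex.sinh (r * om)))
  have e : (((Real.exp (-(v*r^3)/6) : ℝ) : ℂ) * (1 - v * r^5 / 120 * om^2) * om).re = Real.sqrt 3/2 * Real.exp (-(v*r^3)/6) := by
    rw [mul_assoc, Complex.re_ofReal_mul]
    have : (1 - v * r^5 / 120 * om^2) * om = om + ((v * r^5/120 : ℝ) : ℂ) * I := by
      have := om_cube
      push_cast
      linear_combination (-(v * r^5/120 : ℂ)) * this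
    rw [this, Complex.add_re, Complex.re_ofReal_mul, Complex.I_re, om_re]; ring
  rw [← e, ← Complex.sub_re, ← sub_mul]
  refine (Complex.abs_re_le_norm _).trans ?_
  rw [norm_mul, om_norm, mul_one]
  exact h

lemma ray1 {v r : ℝ} (hv : 0 < v) (hr : 0 ≤ r) (hr2 : r ≤ Real.pi) :
    |(Fc 1 v (I * (Real.pi/2) + r * om) * om).re - Real.sqrt 3/2 * ((r + r^3/6 - v*r^6/120) * Real.exp (-(v*r^3)/6))|
      ≤ 20000 * r^5 * Real.exp (-(v*r^3)/40) := by
  have h := ray_exp hv hr hr2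
  have hr10 : r^2 ≤ 10 := (pow_le_pow_left₀ hr hr2 2).trans pi_sq_le
  have hn := ray_norm hr
  have hR := sinh_rem (r * om) (by rw [hn]; exact hr10)
  rw [hn] at hR
  rw [Fc_ray, pow_one]
  set E := Complex.exp (I * v * (r * om - Complex.sinh (r * om))) with hEd
  set S := Complex.sinh (r * om) with hS
  set p : ℂ := r * om + (r * om)^3/6 with hp
  set x : ℝ := Real.exp (-(v*r^3)/6) with hx
  have hxp : 0 < x := Real.exp_pos _
  have hv0 := hv.le
  have h7 : r^7 ≤ 10 * r^5 := by
    calc r^7 = r^5 * r^2 := by ring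
      _ ≤ r^5 * 10 := by gcongr
      _ = _ := by ring
  have hr5 : 0 ≤ r^5 := by positivity
  have h5n : ‖(r * om)^5/120‖ = r^5/120 := by
    rw [norm_div, norm_pow, hn]; norm_num
  have hQ : ‖S - p‖ ≤ r^5 := by
    have : S - p = (S - (r * om + (r * om)^3/6 + (r*om)^5/120)) + (r*om)^5/120 := by rw [hp]; ring
    rw [this]
    refine (norm_add_le _ _).trans ?_
    rw [h5n]; linarith
  have hp_n : ‖p‖ ≤ r + r^3/6 := by
    rw [hp]
    refine (norm_add_le _ _).trans ?_
    rw [norm_div, norm_pow, hn]; norm_num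
  have hSn : ‖S‖ ≤ 4 * r := by
    have : S = (S - (r * om + (r * om)^3/6 + (r*om)^5/120)) + ((r*om)^5/120 + p) := by rw [hp]; ring
    rw [this]
    refine (norm_add_le _ _).trans ?_
    have h2 := norm_add_le ((r*om)^5/120) p
    rw [h5n] at h2
    have h3 : r^3 ≤ 10 * r := by
      calc r^3 = r * r^2 := by ring
        _ ≤ r * 10 := by gcongr
        _ = _ := by ring
    have h5 : r^5 ≤ 10 * r^3 := by
      calc r^5 = r^3 * r^2 := by ring
        _ ≤ r^3 * 10 := by gcongr
        _ = _ := by ring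
    linarith
  set Z : ℂ := (1 - v * r^5 / 120 * om^2) with hZ
  have hZn : ‖Z‖ ≤ Real.exp (v*r^3/12) := by
    have hX0 : ‖(v * r^5 / 120 * om^2 : ℂ)‖ = v * r^5/120 := by
      have : (v * r^5 / 120 * om^2 : ℂ) = ((v * r^5/120 : ℝ) : ℂ) * om^2 := by push_cast; ring
      rw [this, norm_mul, norm_pow, om_norm, Complex.norm_real, Real.norm_of_nonneg (by positivity)]; ring
    have h5 : v * r^5 ≤ 10 * (v * r^3) := by
      calc v * r^5 = (v*r^3) * r^2 := by ring
        _ ≤ (v * r^3) * 10 := by gcongr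
        _ = _ := by ring
    have := norm_sub_le (1:ℂ) (v * r^5 / 120 * om^2)
    rw [hX0, norm_one] at this
    have h12 := Real.add_one_le_exp (v*r^3/12)
    rw [hZ]; linarith
  have e : (I * p * ((x : ℂ) * Z) * om).re = Real.sqrt 3/2 * ((r + r^3/6 - v*r^6/120) * x) := by
    have : I * p * ((x : ℂ) * Z) * om = (x : ℂ) * (((r^3/6 - v*r^6/120 : ℝ) : ℂ) * om + (r : ℂ) * (I * om^2) + ((v * r^8/720 : ℝ) : ℂ) * I) := by
      rw [hp, hZ]
      push_cast
      have o3 := om_cube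
      have i2 := Complex.I_mul_I
      have o4 := om4
      have o6 : om^6 = -1 := by rw [show om^6 = om^3*om^3 by ring, o3]; linear_combination i2
      have : I * (r * om + (r * om)^3/6) * (x * (1 - v * r^5/120 * om^2)) * om
        = x * (I * r * om^2 + I * r^3/6 * om^4 - I * r * v * r^5/120 * om^4 - I * r^3/6 * v * r^5/120 * om^6) := by ring
      rw [this, o4, o6]
      linear_combination (-(x:ℂ) * (r^3/6 - r*v*r^5/120) * om) * i2
    rw [this, Complex.re_ofReal_mul, Complex.add_re, Complex.add_re, Complex.re_ofReal_mul, Complex.re_ofReal_mul, Complex.re_ofReal_mul, om_re, om_sq]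
    simp
    ring
  rw [← e, ← Complex.sub_re, ← sub_mul]
  refine (Complex.abs_re_le_norm _).trans ?_
  rw [norm_mul, om_norm, mul_one]
  have : I * S * E - I * p * ((x:ℂ) * Z) = I * (S * (E - x * Z) + (S - p) * (x * Z)) := by ring
  rw [this, norm_mul, Complex.norm_I, one_mul]
  refine (norm_add_le _ _).trans ?_
  rw [norm_mul, norm_mul, norm_mul, Complex.norm_real, Real.norm_of_nonneg hxp.le]
  have hfin : x * Real.exp (v*r^3/12) ≤ Real.exp (-(v*r^3)/40) := by
    rw [hx, ← Real.exp_add]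
    gcongr
    have : 0 ≤ v*r^3 := by positivity
    linarith
  calc ‖S‖ * ‖E - x * Z‖ + ‖S - p‖ * (x * ‖Z‖)
      ≤ (4*r) * (3240 * r^4 * Real.exp (-(v*r^3)/40)) + r^5 * (x * Real.exp (v*r^3/12)) := by gcongr
    _ ≤ (4*r) * (3240 * r^4 * Real.exp (-(v*r^3)/40)) + r^5 * Real.exp (-(v*r^3)/40) := by gcongr
    _ = 12961 * (r^5 * Real.exp (-(v*r^3)/40)) := by ring
    _ ≤ 20000 * (r^5 * Real.exp (-(v*r^3)/40)) := by
        have : 0 ≤ r^5 * Real.exp (-(v*r^3)/40) := by positivity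
        linarith
    _ = _ := by ring

lemma moment (k : ℕ) {c l : ℝ} (hc : 0 < c) (hl : 0 < l) :
    MeasureTheory.IntegrableOn (fun r : ℝ => r^k * Real.exp (-(l^3*r^3)/c)) (Set.Ioi 0) ∧
    ∫ r in Set.Ioi (0:ℝ), r^k * Real.exp (-(l^3*r^3)/c) =
      c ^ (((k:ℝ)+1)/3) / l^(k+1) * (1/3) * Real.Gamma (((k:ℝ)+1)/3) := by
  have hk : (0:ℝ) ≤ k := Nat.cast_nonneg k
  have hb : 0 < l^3/c := by positivity
  have e : (fun r : ℝ => r^k * Real.exp (-(l^3*r^3)/c)) = fun r : ℝ => r ^ (k:ℝ) * Real.exp (-(l^3/c) * r ^ (3:ℝ)) := by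
    ext r
    rw [Real.rpow_natCast, show (3:ℝ) = ((3:ℕ):ℝ) by norm_num, Real.rpow_natCast]
    congr 2; ring
  rw [e]
  refine ⟨integrableOn_rpow_mul_exp_neg_mul_rpow (by linarith) (by norm_num) hb, ?_⟩
  rw [_root_.integral_rpow_mul_exp_neg_mul_rpow (p := 3) (q := (k:ℝ)) (by norm_num) (by linarith) hb]
  congr 2
  rw [Real.div_rpow (by positivity) hc.le, ← Real.rpow_natCast l 3, ← Real.rpow_mul hl.le, neg_div,
    Real.rpow_neg hc.le, ← Real.rpow_natCast l (k+1)]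
  push_cast
  rw [show (3:ℝ) * -(((k:ℝ)+1)/3) = -((k:ℝ)+1) by ring, Real.rpow_neg hl.le]
  field_simp

lemma split_bound {f m g : ℝ → ℝ} {p : ℝ} (hp : 0 < p) (hf : Continuous f)
    (hm : MeasureTheory.IntegrableOn m (Set.Ioi 0)) (hg : MeasureTheory.IntegrableOn g (Set.Ioi 0))
    (h1 : ∀ r, 0 < r → r ≤ p → |f r - m r| ≤ g r) (h2 : ∀ r, p < r → |m r| ≤ g r) :
    |(∫ r in (0:ℝ)..p, f r) - ∫ r in Set.Ioi (0:ℝ), m r| ≤ ∫ r in Set.Ioi (0:ℝ), g r := by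
  have sub1 : Set.Ioc 0 p ⊆ Set.Ioi (0:ℝ) := Set.Ioc_subset_Ioi_self
  have sub2 : Set.Ioi p ⊆ Set.Ioi (0:ℝ) := Set.Ioi_subset_Ioi hp.le
  have hun : Set.Ioi (0:ℝ) = Set.Ioc 0 p ∪ Set.Ioi p := (Set.Ioc_union_Ioi_eq_Ioi hp.le).symm
  have hdis : Disjoint (Set.Ioc 0 p) (Set.Ioi p) := by
    rw [Set.disjoint_left]; intro x hx hx2; exact absurd hx.2 (not_le.2 hx2)
  have sm : ∫ r in Set.Ioi (0:ℝ), m r = (∫ r in Set.Ioc 0 p, m r) + ∫ r in Set.Ioi p, m r := by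
    rw [hun]; exact MeasureTheory.setIntegral_union hdis measurableSet_Ioi (hm.mono_set sub1) (hm.mono_set sub2)
  have sg : ∫ r in Set.Ioi (0:ℝ), g r = (∫ r in Set.Ioc 0 p, g r) + ∫ r in Set.Ioi p, g r := by
    rw [hun]; exact MeasureTheory.setIntegral_union hdis measurableSet_Ioi (hg.mono_set sub1) (hg.mono_set sub2)
  have hfi : MeasureTheory.IntegrableOn f (Set.Ioc 0 p) :=
    (hf.integrableOn_Icc).mono_set Set.Ioc_subset_Icc_self
  rw [intervalIntegral.integral_of_le hp.le, sm, sg]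
  have e : (∫ r in Set.Ioc 0 p, f r) - ((∫ r in Set.Ioc 0 p, m r) + ∫ r in Set.Ioi p, m r)
      = (∫ r in Set.Ioc 0 p, (f r - m r)) - ∫ r in Set.Ioi p, m r := by
    rw [MeasureTheory.integral_sub hfi (hm.mono_set sub1)]; ring
  rw [e]
  have b1 : |∫ r in Set.Ioc 0 p, (f r - m r)| ≤ ∫ r in Set.Ioc 0 p, g r := by
    rw [← Real.norm_eq_abs]
    refine MeasureTheory.norm_integral_le_of_norm_le (hg.mono_set sub1) ?_
    refine (MeasureTheory.ae_restrict_iff' measurableSet_Ioc).2 (Filter.Eventually.of_forall fun r hr => ?_)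
    exact h1 r hr.1 hr.2
  have b2 : |∫ r in Set.Ioi p, m r| ≤ ∫ r in Set.Ioi p, g r := by
    rw [← Real.norm_eq_abs]
    refine MeasureTheory.norm_integral_le_of_norm_le (hg.mono_set sub2) ?_
    refine (MeasureTheory.ae_restrict_iff' measurableSet_Ioi).2 (Filter.Eventually.of_forall fun r hr => ?_)
    exact h2 r hr
  refine (abs_sub _ _).trans ?_
  exact add_le_add b1 b2

lemma cosh_ge_pi {t : ℝ} (ht : Real.pi * Real.sqrt 3 / 2 ≤ t) : Real.pi ≤ Real.cosh t := by
  have h3 : (1.7:ℝ) ≤ Real.sqrt 3 := Real.le_sqrt_of_sq_le (by norm_num)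
  have hp1 := Real.pi_gt_d2
  have hp2 := Real.pi_lt_d2
  have ht2 : (2.66:ℝ) ≤ t := by nlinarith
  have he := Real.quadratic_le_exp_of_nonneg (x := t) (by linarith)
  rw [Real.cosh_eq]
  have := Real.exp_pos (-t)
  nlinarith

lemma Kn_split (n : ℕ) (hn : n ≤ 2) {v : ℝ} (hv : 0 < v) :
    |Real.exp (Real.pi * v / 2) * Kn n v v - ∫ t in (0:ℝ)..(Real.pi * Real.sqrt 3 / 2), (Fc n v t).re| ≤ 96 / v^3 := by
  set a := Real.pi * Real.sqrt 3 / 2 with ha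
  have ha0 : 0 < a := by have := Real.pi_pos; positivity
  have hi : MeasureTheory.IntegrableOn (fun t : ℝ => (Fc n v t).re) (Set.Ioi 0) := by
    have := (Kn_integrable n v hv).const_mul (Real.exp (Real.pi * v / 2))
    refine this.congr (Filter.Eventually.of_forall fun t => ?_)
    simp only [Fc_real]
  have hia := hi.mono_set (Set.Ioi_subset_Ioi ha0.le)
  have e1 : Real.exp (Real.pi * v / 2) * Kn n v v = ∫ t in Set.Ioi (0:ℝ), (Fc n v t).re := by
    unfold Kn
    rw [← MeasureTheory.integral_const_mul]
    simp only [Fc_real]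
  rw [e1, ← intervalIntegral.integral_interval_add_Ioi hi hia, add_sub_cancel_left, ← Real.norm_eq_abs]
  have hge : MeasureTheory.IntegrableOn (fun t : ℝ => 96/v^3 * Real.exp (-t)) (Set.Ioi a) := (integrableOn_exp_neg_Ioi a).const_mul _
  refine (MeasureTheory.norm_integral_le_of_norm_le hge ?_).trans ?_
  · refine (MeasureTheory.ae_restrict_iff' measurableSet_Ioi).2 (Filter.Eventually.of_forall fun t ht => ?_)
    have hc := cosh_ge_pi (t := t) (le_of_lt ht)
    have hb := cosh_exp_bound 2 (u := v/2) (by positivity) t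
    have h1 := Real.one_le_cosh t
    rw [Fc_real, Real.norm_eq_abs, abs_mul, abs_of_pos (Real.exp_pos _), abs_mul, abs_of_pos (by positivity)]
    calc _ ≤ Real.exp (Real.pi * v / 2) * (Real.cosh t ^ 2 * Real.exp (-v * Real.cosh t) * 1) := by
          gcongr
          exact Real.abs_cos_le_one _
      _ = Real.cosh t ^ 2 * Real.exp (Real.pi * v / 2 + -v * Real.cosh t) := by rw [Real.exp_add]; ring
      _ ≤ Real.cosh t ^ 2 * Real.exp (-(v/2) * Real.cosh t) := by
          gcongr
          nlinarith
      _ ≤ _ := hb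
      _ = _ := by norm_num [Nat.factorial]; field_simp; norm_num
  · rw [MeasureTheory.integral_const_mul, integral_exp_neg_Ioi]
    have : Real.exp (-a) ≤ 1 := Real.exp_le_one_iff.2 (by linarith)
    have h9 : 0 ≤ 96/v^3 := by positivity
    nlinarith

lemma Fc_ray_cont (n : ℕ) (v : ℝ) : Continuous (fun r : ℝ => (Fc n v (I * (Real.pi/2) + r * om) * om).re) := by
  have := (Fc_diff n v).continuous
  exact Complex.continuous_re.comp (by fun_prop)

lemma sqrt3_half : Real.sqrt 3 / 2 ≤ 1 := by
  have : Real.sqrt 3 ≤ 2 := Real.sqrt_le_iff.2 (by norm_num)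
  linarith

lemma exp_cmp {l r : ℝ} (hl : 0 < l) (hr : 0 < r) :
    Real.exp (-(l^3*r^3)/6) ≤ Real.exp (-(l^3*r^3)/40) := by
  have : 0 ≤ l^3*r^3 := by positivity
  exact Real.exp_le_exp.2 (by linarith)

lemma K0_asym : ∃ D, 0 ≤ D ∧ ∀ l : ℝ, 1 ≤ l →
    |Real.exp (Real.pi * l^3 / 2) * Kn 0 (l^3) (l^3) - Real.sqrt 3/2 * (6 ^ ((1:ℝ)/3) / l * (1/3) * Real.Gamma (1/3))| ≤ D / l^4 := by
  refine ⟨3240 * ((40:ℝ) ^ ((5:ℝ)/3) * (1/3) * Real.Gamma (5/3)) + 96, ?_, ?_⟩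
  · have := Real.Gamma_pos_of_pos (show (0:ℝ) < 5/3 by norm_num)
    positivity
  intro l hl
  have hl0 : 0 < l := by linarith
  have hv : 0 < l^3 := by positivity
  have hG := Real.Gamma_pos_of_pos (show (0:ℝ) < 5/3 by norm_num)
  obtain ⟨i0, m0⟩ := moment 0 (c := 6) (by norm_num) hl0
  obtain ⟨i4, m4⟩ := moment 4 (c := 40) (by norm_num) hl0
  have e0 : (6:ℝ) ^ ((((0:ℕ):ℝ)+1)/3) / l^(0+1) * (1/3) * Real.Gamma ((((0:ℕ):ℝ)+1)/3) = 6 ^ ((1:ℝ)/3) / l * (1/3) * Real.Gamma (1/3) := by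
    norm_num
  have e4 : (40:ℝ) ^ ((((4:ℕ):ℝ)+1)/3) / l^(4+1) * (1/3) * Real.Gamma ((((4:ℕ):ℝ)+1)/3) = 40 ^ ((5:ℝ)/3) / l^5 * (1/3) * Real.Gamma (5/3) := by
    norm_num
  have s1 := Kn_split 0 (by norm_num) hv
  rw [contour] at s1
  have s2 := split_bound (p := Real.pi) Real.pi_pos (Fc_ray_cont 0 (l^3)) (i0.const_mul (Real.sqrt 3/2)) (i4.const_mul 3240)
    (fun r hr hr2 => by
      have := ray0 hv hr.le hr2
      simp only [pow_zero, one_mul]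
      rw [← mul_assoc]
      exact this)
    (fun r hr => by
      have hr1 : 1 ≤ r := by have := Real.pi_gt_three; linarith
      have hs := sqrt3_half
      have hs0 : 0 ≤ Real.sqrt 3 / 2 := by positivity
      rw [pow_zero, one_mul, abs_of_nonneg (by positivity)]
      have h4 : 1 ≤ r^4 := one_le_pow₀ hr1
      have hexp := exp_cmp hl0 (by linarith : 0 < r)
      have hep := Real.exp_pos (-(l^3*r^3)/40)
      calc Real.sqrt 3/2 * Real.exp (-(l^3*r^3)/6) ≤ 1 * Real.exp (-(l^3*r^3)/40) := by gcongr
        _ ≤ 3240 * (r^4 * Real.exp (-(l^3*r^3)/40)) := by nlinarith)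
  rw [MeasureTheory.integral_const_mul, MeasureTheory.integral_const_mul, m0, m4, e0, e4] at s2
  have tri := abs_add_le (Real.exp (Real.pi * l^3/2) * Kn 0 (l^3) (l^3) - ∫ r in (0:ℝ)..Real.pi, (Fc 0 (l^3) (I * (Real.pi/2) + r * om) * om).re)
    ((∫ r in (0:ℝ)..Real.pi, (Fc 0 (l^3) (I * (Real.pi/2) + r * om) * om).re) - Real.sqrt 3/2 * (6 ^ ((1:ℝ)/3) / l * (1/3) * Real.Gamma (1/3)))
  rw [sub_add_sub_cancel] at tri
  refine tri.trans ?_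
  have p1 : 96 / (l^3)^3 ≤ 96/l^4 := by
    rw [← pow_mul]
    gcongr
    norm_num
  have p2 : 3240 * ((40:ℝ) ^ ((5:ℝ)/3) / l^5 * (1/3) * Real.Gamma (5/3)) ≤ 3240 * ((40:ℝ) ^ ((5:ℝ)/3) * (1/3) * Real.Gamma (5/3)) / l^4 := by
    have : 3240 * ((40:ℝ) ^ ((5:ℝ)/3) / l^5 * (1/3) * Real.Gamma (5/3)) = 3240 * ((40:ℝ) ^ ((5:ℝ)/3) * (1/3) * Real.Gamma (5/3)) / l^5 := by ring
    rw [this]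
    gcongr
    norm_num
  rw [add_div, add_comm]
  exact add_le_add (s2.trans p2) (s1.trans p1)

lemma m36 {l : ℝ} (hl : 0 < l) :
    l^3 * ((6:ℝ) ^ ((7:ℝ)/3) / l^7 * (1/3) * Real.Gamma (7/3)) = 8 * (6 ^ ((4:ℝ)/3) / l^4 * (1/3) * Real.Gamma (4/3)) := by
  have h1 : Real.Gamma (7/3) = 4/3 * Real.Gamma (4/3) := by
    rw [← Real.Gamma_add_one (by norm_num)]; norm_num
  have h2 : (6:ℝ) ^ ((7:ℝ)/3) = 6 * 6 ^ ((4:ℝ)/3) := by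
    rw [show (7:ℝ)/3 = 1 + 4/3 by norm_num, Real.rpow_add (by norm_num), Real.rpow_one]
  rw [h1, h2]
  field_simp
  norm_num

lemma K1_asym : ∃ D, 0 ≤ D ∧ ∀ l : ℝ, 1 ≤ l →
    |Real.exp (Real.pi * l^3 / 2) * (l^3 * Kn 1 (l^3) (l^3)) - l^3 * (Real.sqrt 3/2 * (6 ^ ((2:ℝ)/3) / l^2 * (1/3) * Real.Gamma (2/3) + 6 ^ ((4:ℝ)/3) / l^4 * (1/3) * Real.Gamma (4/3)/10))| ≤ D / l^2 := by
  refine ⟨20000 * ((40:ℝ) ^ ((6:ℝ)/3) * (1/3) * Real.Gamma (6/3)) + 96, ?_, ?_⟩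
  · have := Real.Gamma_pos_of_pos (show (0:ℝ) < 6/3 by norm_num)
    positivity
  intro l hl
  have hl0 : 0 < l := by linarith
  have hv : 0 < l^3 := by positivity
  have hG := Real.Gamma_pos_of_pos (show (0:ℝ) < 6/3 by norm_num)
  obtain ⟨i1, m1⟩ := moment 1 (c := 6) (by norm_num) hl0
  obtain ⟨i3, m3⟩ := moment 3 (c := 6) (by norm_num) hl0
  obtain ⟨i6, m6⟩ := moment 6 (c := 6) (by norm_num) hl0
  obtain ⟨i5, m5⟩ := moment 5 (c := 40) (by norm_num) hl0
  rw [show (6:ℝ) ^ ((((1:ℕ):ℝ)+1)/3) / l^(1+1) * (1/3) * Real.Gamma ((((1:ℕ):ℝ)+1)/3) = 6 ^ ((2:ℝ)/3) / l^2 * (1/3) * Real.Gamma (2/3) by norm_num] at m1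
  rw [show (6:ℝ) ^ ((((3:ℕ):ℝ)+1)/3) / l^(3+1) * (1/3) * Real.Gamma ((((3:ℕ):ℝ)+1)/3) = 6 ^ ((4:ℝ)/3) / l^4 * (1/3) * Real.Gamma (4/3) by norm_num] at m3
  rw [show (6:ℝ) ^ ((((6:ℕ):ℝ)+1)/3) / l^(6+1) * (1/3) * Real.Gamma ((((6:ℕ):ℝ)+1)/3) = 6 ^ ((7:ℝ)/3) / l^7 * (1/3) * Real.Gamma (7/3) by norm_num] at m6
  rw [show (40:ℝ) ^ ((((5:ℕ):ℝ)+1)/3) / l^(5+1) * (1/3) * Real.Gamma ((((5:ℕ):ℝ)+1)/3) = 40 ^ ((6:ℝ)/3) / l^6 * (1/3) * Real.Gamma (6/3) by norm_num] at m5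
  have s1 := Kn_split 1 (by norm_num) hv
  rw [contour] at s1
  have hfe : (fun r : ℝ => Real.sqrt 3/2 * ((r + r^3/6 - l^3*r^6/120) * Real.exp (-(l^3*r^3)/6))) =
      fun r : ℝ => Real.sqrt 3/2 * (r^1 * Real.exp (-(l^3*r^3)/6)) + Real.sqrt 3/2/6 * (r^3 * Real.exp (-(l^3*r^3)/6)) - Real.sqrt 3/2*l^3/120 * (r^6 * Real.exp (-(l^3*r^3)/6)) := by
    ext r; ring
  have j1 := i1.const_mul (Real.sqrt 3/2)
  have j3 := i3.const_mul (Real.sqrt 3/2/6)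
  have j6 := i6.const_mul (Real.sqrt 3/2*l^3/120)
  have jj : MeasureTheory.IntegrableOn (fun r : ℝ => Real.sqrt 3/2 * ((r + r^3/6 - l^3*r^6/120) * Real.exp (-(l^3*r^3)/6))) (Set.Ioi 0) := by
    rw [hfe]; exact (j1.add j3).sub j6
  have jv : ∫ r in Set.Ioi (0:ℝ), Real.sqrt 3/2 * ((r + r^3/6 - l^3*r^6/120) * Real.exp (-(l^3*r^3)/6)) =
      Real.sqrt 3/2 * (6 ^ ((2:ℝ)/3) / l^2 * (1/3) * Real.Gamma (2/3) + 6 ^ ((4:ℝ)/3) / l^4 * (1/3) * Real.Gamma (4/3)/10) := by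
    rw [hfe]
    have a1 := MeasureTheory.integral_sub (j1.add j3) j6
    have a2 := MeasureTheory.integral_add j1 j3
    simp only [Pi.add_apply] at a1
    rw [a1, a2, MeasureTheory.integral_const_mul, MeasureTheory.integral_const_mul, MeasureTheory.integral_const_mul, m1, m3, m6]
    have := m36 hl0
    linear_combination (-(Real.sqrt 3/2/120)) * this
  have s2 := split_bound (p := Real.pi) Real.pi_pos (Fc_ray_cont 1 (l^3)) jj (i5.const_mul 20000)
    (fun r hr hr2 => by
      exact (ray1 hv hr.le hr2).trans_eq (mul_assoc _ _ _))
    (fun r hr => by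
      have hr1 : 1 ≤ r := by have := Real.pi_gt_three; linarith
      have hr0 : 0 < r := by linarith
      have hs := sqrt3_half
      have hs0 : 0 ≤ Real.sqrt 3 / 2 := by positivity
      set y := l^3*r^3 with hy
      have hy0 : 0 ≤ y := by positivity
      have h5 : 1 ≤ r^5 := one_le_pow₀ hr1
      have hr5 : r ≤ r^5 := by simpa using pow_le_pow_right₀ hr1 (show 1 ≤ 5 by norm_num)
      have hr35 : r^3 ≤ r^5 := pow_le_pow_right₀ hr1 (by norm_num)
      have he : Real.exp (-y/6) = Real.exp (-y/12) * Real.exp (-y/12) := by rw [← Real.exp_add]; ring_nf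
      have hle1 : Real.exp (-y/12) ≤ 1 := Real.exp_le_one_iff.2 (by linarith)
      have hle2 : Real.exp (-y/12) ≤ Real.exp (-y/40) := Real.exp_le_exp.2 (by linarith)
      have hye : y * Real.exp (-y/12) ≤ 12 := by
        have h1 := Real.add_one_le_exp (y/12)
        have h2 : Real.exp (y/12) * Real.exp (-y/12) = 1 := by rw [← Real.exp_add]; simp [neg_div]
        have := Real.exp_pos (-y/12)
        nlinarith
      have e12 := Real.exp_pos (-y/12)
      have e40 := Real.exp_pos (-y/40)
      have habs : |r + r^3/6 - l^3*r^6/120| ≤ 2*r^5 + y*r^5 := by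
        have : l^3*r^6 = y*r^3 := by rw [hy]; ring
        rw [this]
        have : 0 ≤ y*r^3 := by positivity
        have : y*r^3 ≤ y*r^5 := by gcongr
        have : 0 ≤ r^3 := by positivity
        rw [abs_le]; constructor <;> linarith
      rw [abs_mul, abs_mul, abs_of_nonneg hs0, abs_of_pos (Real.exp_pos _), he]
      calc Real.sqrt 3/2 * (|r + r^3/6 - l^3*r^6/120| * (Real.exp (-y/12) * Real.exp (-y/12)))
          ≤ 1 * ((2*r^5 + y*r^5) * (Real.exp (-y/12) * Real.exp (-y/40))) := by gcongr
        _ = r^5 * Real.exp (-y/40) * (2*Real.exp (-y/12) + y*Real.exp (-y/12)) := by ring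
        _ ≤ r^5 * Real.exp (-y/40) * (2*1+12) := by gcongr
        _ ≤ _ := by
          have : 0 < r^5 * Real.exp (-y/40) := by positivity
          linarith)
  rw [jv, MeasureTheory.integral_const_mul, m5] at s2
  have tri := abs_add_le (Real.exp (Real.pi * l^3/2) * Kn 1 (l^3) (l^3) - ∫ r in (0:ℝ)..Real.pi, (Fc 1 (l^3) (I * (Real.pi/2) + r * om) * om).re)
    ((∫ r in (0:ℝ)..Real.pi, (Fc 1 (l^3) (I * (Real.pi/2) + r * om) * om).re) - Real.sqrt 3/2 * (6 ^ ((2:ℝ)/3) / l^2 * (1/3) * Real.Gamma (2/3) + 6 ^ ((4:ℝ)/3) / l^4 * (1/3) * Real.Gamma (4/3)/10))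
  rw [sub_add_sub_cancel] at tri
  have tri2 := tri.trans (add_le_add s1 s2)
  have p1 : l^3 * (96 / (l^3)^3) ≤ 96/l^2 := by
    have : l^3 * (96 / (l^3)^3) = 96 / l^6 := by field_simp
    rw [this]
    gcongr
    · norm_num
  have p2 : l^3 * (20000 * ((40:ℝ) ^ ((6:ℝ)/3) / l^6 * (1/3) * Real.Gamma (6/3))) ≤ 20000 * ((40:ℝ) ^ ((6:ℝ)/3) * (1/3) * Real.Gamma (6/3)) / l^2 := by
    have : l^3 * (20000 * ((40:ℝ) ^ ((6:ℝ)/3) / l^6 * (1/3) * Real.Gamma (6/3))) = 20000 * ((40:ℝ) ^ ((6:ℝ)/3) * (1/3) * Real.Gamma (6/3)) / l^3 := by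
      field_simp
    rw [this]
    gcongr
    norm_num
  calc _ = l^3 * |Real.exp (Real.pi * l^3/2) * Kn 1 (l^3) (l^3) - Real.sqrt 3/2 * (6 ^ ((2:ℝ)/3) / l^2 * (1/3) * Real.Gamma (2/3) + 6 ^ ((4:ℝ)/3) / l^4 * (1/3) * Real.Gamma (4/3)/10)| := by
        rw [← abs_of_pos hv, ← abs_mul, abs_of_pos hv]; congr 1; ring
    _ ≤ l^3 * (96 / (l^3)^3 + 20000 * ((40:ℝ) ^ ((6:ℝ)/3) / l^6 * (1/3) * Real.Gamma (6/3))) := by gcongr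
    _ ≤ _ := by rw [mul_add, add_div]; linarith

def av (l : ℝ) : ℝ := l * (1/2) ^ ((1:ℝ)/3)

lemma av_pos {l : ℝ} (hl : 0 < l) : 0 < av l := by unfold av; positivity

lemma av_cube (l : ℝ) : 2 * (av l)^3 = l^3 := by
  unfold av
  rw [mul_pow, ← Real.rpow_natCast ((1/2 : ℝ)^((1:ℝ)/3)) 3, ← Real.rpow_mul (by norm_num)]
  norm_num
  ring

lemma six_third {l : ℝ} (hl : 0 < l) :
    (6:ℝ) ^ ((1:ℝ)/3) / l = (av l)⁻¹ / ((1/3:ℝ)^((1:ℝ)/6))^2 := by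
  have h2 : (6:ℝ) ^ ((1:ℝ)/3) * (1/2 : ℝ)^((1:ℝ)/3) * ((1/3:ℝ)^((1:ℝ)/6))^2 = 1 := by
    rw [← Real.rpow_natCast ((1/3 : ℝ)^((1:ℝ)/6)) 2, ← Real.rpow_mul (by norm_num),
      show (1:ℝ)/6 * ((2:ℕ):ℝ) = 1/3 by norm_num, ← Real.mul_rpow (by norm_num) (by norm_num),
      ← Real.mul_rpow (by norm_num) (by norm_num)]
    norm_num
  unfold av
  have h3 : 0 < (1/2 : ℝ)^((1:ℝ)/3) := by positivity
  have h4 : 0 < (1/3 : ℝ)^((1:ℝ)/6) := by positivity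
  generalize (1/2 : ℝ)^((1:ℝ)/3) = p at *
  generalize (1/3 : ℝ)^((1:ℝ)/6) = q at *
  field_simp
  linarith

lemma sqrt3_b0 : Real.sqrt 3 * ((1/3:ℝ)^((1:ℝ)/6))^3 = 1 := by
  rw [Real.sqrt_eq_rpow, ← Real.rpow_natCast ((1/3 : ℝ)^((1:ℝ)/6)) 3, ← Real.rpow_mul (by norm_num),
      show (1:ℝ)/6 * ((3:ℕ):ℝ) = 1/2 by norm_num, ← Real.mul_rpow (by norm_num) (by norm_num)]
  norm_num

lemma gam_refl : Real.Gamma (1/3) * Real.Gamma (2/3) * Real.sqrt 3 = 2 * Real.pi := by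
  have := Real.Gamma_mul_Gamma_one_sub (1/3)
  rw [show (1:ℝ) - 1/3 = 2/3 by norm_num, show Real.pi * (1/3) = Real.pi/3 by ring, Real.sin_pi_div_three] at this
  rw [this]
  have : 0 < Real.sqrt 3 := by positivity
  field_simp

lemma gam_43 : Real.Gamma (4/3) = Real.Gamma (1/3) / 3 := by
  have := Real.Gamma_add_one (show (1/3:ℝ) ≠ 0 by norm_num)
  norm_num at this ⊢
  linarith

lemma match0 {l : ℝ} (hl : 0 < l) :
    Real.sqrt 3/2 * (6 ^ ((1:ℝ)/3) / l * (1/3) * Real.Gamma (1/3)) =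
    Real.pi/Real.sqrt 3*((av l)⁻¹*(1/3)^((1:ℝ)/6)*(1/Real.Gamma (2/3))) := by
  rw [six_third hl]
  have ha := av_pos hl
  have h4 : 0 < (1/3 : ℝ)^((1:ℝ)/6) := by positivity
  have hs := sqrt3_b0
  have h6 := b0_pow
  have hr := gam_refl
  have g1 := Real.Gamma_pos_of_pos (show (0:ℝ) < 1/3 by norm_num)
  have g2 := Real.Gamma_pos_of_pos (show (0:ℝ) < 2/3 by norm_num)
  have h3 : Real.sqrt 3 * Real.sqrt 3 = 3 := Real.mul_self_sqrt (by norm_num)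
  have h3p : 0 < Real.sqrt 3 := by positivity
  have hpi : Real.pi = Real.Gamma (1/3) * Real.Gamma (2/3) * Real.sqrt 3 / 2 := by linarith
  rw [hpi]
  generalize (1/3 : ℝ)^((1:ℝ)/6) = q at *
  generalize Real.sqrt 3 = s at *
  generalize Real.Gamma (1/3) = x at *
  generalize Real.Gamma (2/3) = y at *
  have : s = 1/q^3 := by field_simp; exact hs
  subst this
  field_simp
  field_simp at h6
  linarith

lemma match1 {l : ℝ} (hl : 0 < l) :
    l^3 * (Real.sqrt 3/2 * (6 ^ ((2:ℝ)/3) / l^2 * (1/3) * Real.Gamma (2/3) + 6 ^ ((4:ℝ)/3) / l^4 * (1/3) * Real.Gamma (4/3)/10)) =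
    Real.pi/Real.sqrt 3*((av l)⁻¹*(1/3)^((1:ℝ)/6)*(1/Real.Gamma (2/3))/5 + 2*(av l)*((1/3)^((1:ℝ)/6))^5*(1/Real.Gamma (4/3))) := by
  have e2 : (6:ℝ)^((2:ℝ)/3) / l^2 = ((6:ℝ)^((1:ℝ)/3)/l)^2 := by
    rw [div_pow, ← Real.rpow_natCast ((6:ℝ)^((1:ℝ)/3)) 2, ← Real.rpow_mul (by norm_num)]; norm_num
  have e4 : (6:ℝ)^((4:ℝ)/3) / l^4 = ((6:ℝ)^((1:ℝ)/3)/l)^4 := by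
    rw [div_pow, ← Real.rpow_natCast ((6:ℝ)^((1:ℝ)/3)) 4, ← Real.rpow_mul (by norm_num)]; norm_num
  rw [e2, e4, six_third hl, gam_43, ← av_cube l]
  have ha := av_pos hl
  have h4 : 0 < (1/3 : ℝ)^((1:ℝ)/6) := by positivity
  have hs := sqrt3_b0
  have h6 := b0_pow
  have hr := gam_refl
  have g1 := Real.Gamma_pos_of_pos (show (0:ℝ) < 1/3 by norm_num)
  have g2 := Real.Gamma_pos_of_pos (show (0:ℝ) < 2/3 by norm_num)
  have h3p : 0 < Real.sqrt 3 := by positivity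
  have hpi : Real.pi = Real.Gamma (1/3) * Real.Gamma (2/3) * Real.sqrt 3 / 2 := by linarith
  rw [hpi]
  generalize (1/3 : ℝ)^((1:ℝ)/6) = q at *
  generalize Real.sqrt 3 = s at *
  generalize Real.Gamma (1/3) = x at *
  generalize Real.Gamma (2/3) = y at *
  generalize av l = a at *
  have : s = 1/q^3 := by field_simp; exact hs
  subst this
  have h12 : q^12 = 1/9 := by rw [show q^12 = (q^6)^2 by ring, h6]; norm_num
  field_simp
  rw [h12]
  ring

lemma ay0 : ∃ D, 0 ≤ D ∧ ∀ l : ℝ, 1 ≤ l →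
    |Real.pi/Real.sqrt 3*((av l)⁻¹*(1/3)^((1:ℝ)/6)*(1/Real.Gamma (2/3)))| ≤ D * l⁻¹ := by
  have g2 := Real.Gamma_pos_of_pos (show (0:ℝ) < 2/3 by norm_num)
  refine ⟨Real.pi/Real.sqrt 3*(((1/2:ℝ) ^ ((1:ℝ)/3))⁻¹*(1/3)^((1:ℝ)/6)*(1/Real.Gamma (2/3))), by positivity, fun l hl => ?_⟩
  have := av_pos (by linarith : 0 < l)
  rw [abs_of_nonneg (by positivity)]
  unfold av
  rw [mul_inv]
  apply le_of_eq; ring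

lemma ay1 : ∃ D, 0 ≤ D ∧ ∀ l : ℝ, 1 ≤ l →
    |Real.pi/Real.sqrt 3*((av l)⁻¹*(1/3)^((1:ℝ)/6)*(1/Real.Gamma (2/3))/5 + 2*(av l)*((1/3)^((1:ℝ)/6))^5*(1/Real.Gamma (4/3)))| ≤ D * l^2 * l⁻¹ := by
  have g2 := Real.Gamma_pos_of_pos (show (0:ℝ) < 2/3 by norm_num)
  have g4 := Real.Gamma_pos_of_pos (show (0:ℝ) < 4/3 by norm_num)
  refine ⟨Real.pi/Real.sqrt 3*(((1/2:ℝ) ^ ((1:ℝ)/3))⁻¹*(1/3)^((1:ℝ)/6)*(1/Real.Gamma (2/3))/5 + 2*((1/2:ℝ) ^ ((1:ℝ)/3))*((1/3)^((1:ℝ)/6))^5*(1/Real.Gamma (4/3))), by positivity, fun l hl => ?_⟩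
  have hl0 : 0 < l := by linarith
  have := av_pos (by linarith : 0 < l)
  rw [abs_of_nonneg (by positivity), mul_assoc _ (l^2), show l^2*l⁻¹ = l by field_simp]
  unfold av
  rw [mul_inv, mul_assoc (Real.pi/Real.sqrt 3) _ l, add_mul]
  have hi : l⁻¹ ≤ l := (inv_le_one_of_one_le₀ hl).trans hl
  have k : l⁻¹ * ((1/2:ℝ) ^ ((1:ℝ)/3))⁻¹*(1/3)^((1:ℝ)/6)*(1/Real.Gamma (2/3))/5 ≤ ((1/2:ℝ) ^ ((1:ℝ)/3))⁻¹*(1/3)^((1:ℝ)/6)*(1/Real.Gamma (2/3))/5 * l := by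
    have : 0 ≤ ((1/2:ℝ) ^ ((1:ℝ)/3))⁻¹*(1/3)^((1:ℝ)/6)*(1/Real.Gamma (2/3))/5 := by positivity
    nlinarith
  have k2 := add_le_add_left k (2 * (l * ((1/2:ℝ) ^ ((1:ℝ)/3)))*((1/3)^((1:ℝ)/6))^5*(1/Real.Gamma (4/3)))
  refine mul_le_mul_of_nonneg_left ?_ (by positivity)
  refine k2.trans ?_
  apply le_of_eq
  ring

lemma core : ∃ C, 0 < C ∧ ∀ l t : ℝ, 1 ≤ l → 0 < t → t ≤ 2 → |Wm (l^3) t - Am (l^3) t| ≤ C * (l^4)⁻¹ := by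
  obtain ⟨B, hB, hR⟩ := Rf_bound
  obtain ⟨D0, hD0, h0⟩ := ay0
  obtain ⟨D1, hD1, h1⟩ := ay1
  obtain ⟨E0, hE0, k0⟩ := K0_asym
  obtain ⟨E1, hE1, k1⟩ := K1_asym
  obtain ⟨C1, hC1, en1⟩ := energy_main B (D0 + D1) hB (by positivity)
  obtain ⟨C2, hC2, en2⟩ := energy_main (B * C1) (E0 + E1) (by positivity) (by positivity)
  refine ⟨C2, hC2, fun l t hl ht ht2 => ?_⟩
  have hl0 : 0 < l := by linarith
  have ha := av_pos hl0
  have hv : 0 < l^3 := by positivity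
  have hA0 := Am_tendsto ha
  have hA1 := Am1_tendsto ha
  rw [av_cube] at hA0 hA1
  have bA : ∀ t, 0 < t → t ≤ 2 → |Am (l^3) t| ≤ C1 * l⁻¹ := by
    refine en1 l l⁻¹ (Am (l^3)) (Am1 (l^3)) (fun t => Rf t * Am (l^3) t) _ _ hl (by positivity)
      (fun t ht _ => Am_deriv hv ht) (fun t ht _ => Am1_deriv hv ht) ?_ hA0 hA1 ?_ ?_
    · intro t ht ht2
      rw [abs_mul]
      have := hR t ht ht2
      have : 0 ≤ l^3 * l⁻¹ := by positivity
      calc |Rf t| * |Am (l^3) t| ≤ B * |Am (l^3) t| := by gcongr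
        _ ≤ B * (|Am (l^3) t| + l^3 * l⁻¹) := by gcongr; linarith
    · refine (h0 l hl).trans ?_
      gcongr; linarith
    · refine (h1 l hl).trans ?_
      gcongr; linarith
  refine en2 l (l^4)⁻¹ (fun t => Wm (l^3) t - Am (l^3) t) (fun t => Wm1 (l^3) t - Am1 (l^3) t)
    (fun t => -(Rf t * Am (l^3) t)) _ _ hl (by positivity)
      (fun t ht _ => (Wm_deriv hv t).sub (Am_deriv hv ht))
      (fun t ht _ => ((Wm1_deriv hv t).sub (Am1_deriv hv ht)).congr_deriv (by ring)) ?_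
      ((Wm_tendsto hv).sub hA0) ((Wm1_tendsto hv).sub hA1) ?_ ?_ t ht ht2
  · intro t ht ht2
    rw [abs_neg, abs_mul]
    have hb := hR t ht ht2
    have ha := bA t ht ht2
    calc |Rf t| * |Am (l^3) t| ≤ B * (C1 * l⁻¹) := by gcongr
      _ = B * C1 * (0 + l^3 * (l^4)⁻¹) := by field_simp; ring
      _ ≤ _ := by gcongr; positivity
  · have := k0 l hl
    rw [match0 hl0] at this
    unfold Wm
    rw [neg_zero, Real.exp_zero, mul_one]
    refine this.trans ?_
    rw [div_eq_mul_inv]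
    gcongr; linarith
  · have := k1 l hl
    rw [match1 hl0] at this
    unfold Wm1
    rw [neg_zero, Real.exp_zero, mul_one]
    refine this.trans ?_
    have : (E0 + E1) * l^2 * (l^4)⁻¹ = (E0+E1) / l^2 := by field_simp
    rw [this]
    gcongr; linarith

/-- Proposition A.2 (Andersen–Duke): for every `c > 0` there are `C > 0` and a continuously
differentiable `θ_{1/3} : (0,∞) → ℝ` with `θ_{1/3}'(t) = 2/(π t M_{1/3}(t)²)`, such that for
all `v ≥ 1` and `3/16 ≤ z ≤ 1 - c v^{-2/3}`,
`|e^{πv/2} K_{iv}(vz) - π (w(z)^{1/2}/(1-z²)^{1/4}) M_{1/3}(v w(z)) sin(θ_{1/3}(v w(z)))|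
  ≤ C v^{-4/3}`. -/
theorem kbessel_asymptotic_transition :
    ∀ c : ℝ, 0 < c → ∃ C : ℝ, 0 < C ∧ ∃ θ₁₃ : ℝ → ℝ,
      (∀ t : ℝ, 0 < t → HasDerivAt θ₁₃ (2 / (Real.pi * t * M13 t ^ 2)) t) ∧
      (ContinuousOn (fun t : ℝ => 2 / (Real.pi * t * M13 t ^ 2)) (Set.Ioi 0)) ∧
      ∀ v z : ℝ, 1 ≤ v → 3/16 ≤ z → z ≤ 1 - c * v ^ (-(2 : ℝ)/3) →
        |Real.exp (Real.pi * v / 2) * Kbes v (v * z)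
            - Real.pi * (wfun z ^ ((1 : ℝ)/2) / (1 - z ^ 2) ^ ((1 : ℝ)/4)) *
                M13 (v * wfun z) * Real.sin (θ₁₃ (v * wfun z))|
          ≤ C * v ^ (-(4 : ℝ)/3) := by
  intro c hc
  obtain ⟨C, hC, hcore⟩ := core
  obtain ⟨θ, hθ, hM⟩ := theta_exists
  refine ⟨C, hC, θ, hθ, theta_cont, ?_⟩
  intro v z hv hz hz1
  have hv0 : 0 < v := by linarith
  have hz0 : 0 < z := by linarith
  have hzlt : z < 1 := by
    have : 0 < c * v ^ (-(2:ℝ)/3) := by positivity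
    linarith
  obtain ⟨t, rfl⟩ : ∃ t, Real.exp (-t) = z := ⟨-Real.log z, by rw [neg_neg, Real.exp_log hz0]⟩
  have ht : 0 < t := by
    have := Real.exp_lt_one_iff.1 hzlt
    linarith
  have ht2 : t ≤ 2 := by
    by_contra hcon
    have h1 : Real.exp (-t) < Real.exp (-2) := Real.exp_lt_exp.2 (by linarith)
    have h2 : Real.exp (-2) * Real.exp 2 = 1 := by rw [← Real.exp_add]; simp
    have h3 : Real.exp 2 = Real.exp 1 * Real.exp 1 := by rw [← Real.exp_add]; norm_num
    have h4 := Real.exp_one_gt_d9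
    have h5 : 7 ≤ Real.exp 2 := by rw [h3]; nlinarith
    have h6 := Real.exp_pos (-2)
    nlinarith
  set l := v ^ ((1:ℝ)/3) with hl
  have hl1 : 1 ≤ l := Real.one_le_rpow hv (by norm_num)
  have hl3 : l^3 = v := by
    rw [hl, ← Real.rpow_natCast, ← Real.rpow_mul hv0.le]; norm_num
  have hl4 : v ^ (-(4:ℝ)/3) = (l^4)⁻¹ := by
    rw [hl, ← Real.rpow_natCast, ← Real.rpow_mul hv0.le, ← Real.rpow_neg hv0.le]; norm_num
  have hmain := hcore l t hl1 ht ht2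
  rw [hl3] at hmain
  rw [hl4]
  have hwp := wt_pos ht
  have hTp := Tf_pos ht
  have hq : (1 - Real.exp (-t) ^ 2) ^ ((1:ℝ)/4) = Real.sqrt (Tf t) := by
    have : 1 - Real.exp (-t)^2 = Tf t ^ 2 := by
      rw [Tf_sq ht.le, ← Real.exp_nat_mul]; push_cast; ring_nf
    rw [this, Real.sqrt_eq_rpow, ← Real.rpow_natCast, ← Real.rpow_mul hTp.le]; norm_num
  have hAm : Real.pi * (wfun (Real.exp (-t)) ^ ((1 : ℝ)/2) / (1 - Real.exp (-t) ^ 2) ^ ((1 : ℝ)/4)) *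
      M13 (v * wfun (Real.exp (-t))) * Real.sin (θ (v * wfun (Real.exp (-t)))) = Am v t := by
    rw [wfun_eq_wt ht.le, hq, mul_assoc _ (M13 _), hM _ (by positivity), ← Real.sqrt_eq_rpow]
    unfold Am Pf fB
    ring
  rw [hAm, Kbes_eq_Kn]
  exact hmain

end
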